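/- Assume m, n ≥ 2 and let u, v ≥ 1 be integers with cu − dv = 1. For i ∈ ℤ, there exists a sequence of m+n−1 elements of the irrelevant maximal ideal 𝔪 of R (the ideal of R spanned by all monomials of positive degree) that is a regular sequence on the R-module M_i if and only if both inequalities 1 − ⌈(m − vi)/c⌉ ≤ ⌈ui/d⌉ and 1 − ⌈(n − ui)/d⌉ ≤ ⌈vi/c⌉ hold, where the ceilings are of the indicated rational numbers. (Since the Krull dimension of R is m+n−1, this says exactly that M_i is a Cohen–Macaulay R-module if and only if both inequalities hold.) -/

import Mathlib

open MvPolynomial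

/-- Sum of the `X`-exponents of a monomial exponent vector. -/
def xsum (m n : ℕ) (σ : (Fin m ⊕ Fin n) →₀ ℕ) : ℤ :=
  ∑ a : Fin m, (σ (Sum.inl a) : ℤ)

/-- Sum of the `Y`-exponents of a monomial exponent vector. -/
def ysum (m n : ℕ) (σ : (Fin m ⊕ Fin n) →₀ ℕ) : ℤ :=
  ∑ b : Fin n, (σ (Sum.inr b) : ℤ)

/-- The Segre product `R = R₁^{(c)} # R₂^{(d)}` of the `c`-th Veronese subring of
`K[X₁,…,X_m]` and the `d`-th Veronese subring of `K[Y₁,…,Y_n]`: the `K`-subalgebra of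
`P = K[X₁,…,X_m,Y₁,…,Y_n]` spanned by all monomials with `d|α| = c|β|`. -/
noncomputable def veroneseSegreRing (K : Type*) [Field K] (m n c d : ℕ) :
    Subalgebra K (MvPolynomial (Fin m ⊕ Fin n) K) :=
  Algebra.adjoin K
    {f | ∃ σ, (d : ℤ) * xsum m n σ = (c : ℤ) * ysum m n σ ∧ f = monomial σ (1 : K)}

/-- The class module `M_i`: the subspace of `P` spanned by all monomials with
`d|α| - c|β| = i`, as a module over `R = R₁^{(c)} # R₂^{(d)}`. -/
noncomputable def veroneseSegreClassModule (K : Type*) [Field K] (m n c d : ℕ) (i : ℤ) :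
    Submodule (veroneseSegreRing K m n c d) (MvPolynomial (Fin m ⊕ Fin n) K) :=
  Submodule.span (veroneseSegreRing K m n c d)
    {f | ∃ σ, (d : ℤ) * xsum m n σ - (c : ℤ) * ysum m n σ = i ∧ f = monomial σ (1 : K)}

set_option synthInstance.maxHeartbeats 1000000
set_option maxHeartbeats 1000000

/-- The irrelevant maximal ideal `𝔪` of `R = R₁^{(c)} # R₂^{(d)}`: the ideal of `R`
spanned by all monomials of positive degree. -/
noncomputable def veroneseSegreIrrelevantIdeal (K : Type*) [Field K] (m n c d : ℕ) :
    Ideal (veroneseSegreRing K m n c d) :=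
  Ideal.span {r | ∃ σ : (Fin m ⊕ Fin n) →₀ ℕ, σ ≠ 0 ∧
    (r : MvPolynomial (Fin m ⊕ Fin n) K) = MvPolynomial.monomial σ (1 : K)}

section RegularSequences

open RingTheory.Sequence Function
open scoped Pointwise

/-- Given an exact sequence `0 → A → Q → C → 0`, a sequence which is weakly regular on `A` and `C`
is weakly regular on `Q`. -/
theorem RingTheory.Sequence.IsWeaklyRegular.of_exact {T : Type*} [CommRing T] (L : List T) :
    ∀ {A Q C : Type*} [AddCommGroup A] [AddCommGroup Q] [AddCommGroup C] [Module T A]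
      [Module T Q] [Module T C] (f : A →ₗ[T] Q) (g : Q →ₗ[T] C), Injective f → Exact f g →
      Surjective g → IsWeaklyRegular A L → IsWeaklyRegular C L → IsWeaklyRegular Q L := by
  induction L with
  | nil => intros; exact .nil _ _
  | cons x L ih =>
    intro A Q C _ _ _ _ _ _ f g hf hfg hg hA hC
    rw [isWeaklyRegular_cons_iff] at hA hC ⊢
    refine ⟨isSMulRegular_of_range_eq_ker hf hfg.linearMap_ker_eq.symm hA.1 hC.1, ?_⟩
    refine ih (QuotSMulTop.map x f) (QuotSMulTop.map x g) ?_ ?_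
      (QuotSMulTop.map_surjective x hg) hA.2 hC.2
    · have h0 : Exact (0 : PUnit.{1} →ₗ[T] A) f := by
        rw [LinearMap.exact_iff, LinearMap.range_zero, LinearMap.ker_eq_bot.mpr hf]
      have := QuotSMulTop.map_first_exact_on_four_term_exact_of_isSMulRegular_last h0 hfg hC.1
      rw [← LinearMap.ker_eq_bot, this.linearMap_ker_eq, LinearMap.range_eq_bot]
      ext a
      simp
    · exact QuotSMulTop.map_exact x hfg hg

/-- If multiplication by `x` on `B` factors through injections `w : B → B'` and `z : B' → B`,
then a sequence which is weakly regular on both cokernels may be prolonged by `x` to a weakly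
regular sequence on `B`. -/
theorem RingTheory.Sequence.IsWeaklyRegular.cons_of_factorization {T : Type*} [CommRing T]
    {A B B' C : Type*} [AddCommGroup A] [AddCommGroup B] [AddCommGroup B'] [AddCommGroup C]
    [Module T A] [Module T B] [Module T B'] [Module T C] {x : T} {L : List T}
    {w : B →ₗ[T] B'} {z : B' →ₗ[T] B} {g : B' →ₗ[T] A} {h : B →ₗ[T] C}
    (hw : Injective w) (hz : Injective z) (hwg : Exact w g) (hg : Surjective g)
    (hzh : Exact z h) (hh : Surjective h) (hx : ∀ b, z (w b) = x • b)
    (hA : IsWeaklyRegular A L) (hC : IsWeaklyRegular C L) : IsWeaklyRegular B (x :: L) := by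
  have hxw : ∀ b, w (z b) = x • b := fun b ↦ hz (by rw [hx, map_smul])
  have hreg : IsSMulRegular B x := fun a b hab ↦ hw (hz (by simpa only [hx] using hab))
  refine .cons hreg ?_
  let zbar : B' →ₗ[T] QuotSMulTop x B := (Submodule.mkQ _).comp z
  have hker : LinearMap.ker g ≤ LinearMap.ker zbar := by
    rw [hwg.linearMap_ker_eq]
    rintro _ ⟨b, rfl⟩
    rw [LinearMap.mem_ker, LinearMap.comp_apply, Submodule.mkQ_apply,
      Submodule.Quotient.mk_eq_zero, hx]
    exact Submodule.smul_mem_pointwise_smul b x ⊤ trivial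
  let e := g.quotKerEquivOfSurjective hg
  let f : A →ₗ[T] QuotSMulTop x B := ((LinearMap.ker g).liftQ zbar hker).comp e.symm.toLinearMap
  have hf : ∀ b, f (g b) = zbar b := fun b ↦ by
    have : e.symm (g b) = Submodule.Quotient.mk b := by
      rw [LinearEquiv.symm_apply_eq]; rfl
    simp [f, this]
  have hker' : x • (⊤ : Submodule T B) ≤ LinearMap.ker h := by
    rw [hzh.linearMap_ker_eq]
    rintro _ ⟨b, -, rfl⟩
    exact ⟨w b, hx b⟩
  let q : QuotSMulTop x B →ₗ[T] C := Submodule.liftQ _ h hker'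
  refine .of_exact L f q ?_ ?_ ?_ hA hC
  · rw [← LinearMap.ker_eq_bot, LinearMap.ker_eq_bot']
    intro a ha
    obtain ⟨b, rfl⟩ := hg a
    rw [hf, LinearMap.comp_apply, Submodule.mkQ_apply, Submodule.Quotient.mk_eq_zero] at ha
    obtain ⟨c, -, hc⟩ := ha
    have : b = w c := hz (by rw [hx]; exact hc.symm)
    rw [this, hwg.apply_apply_eq_zero]
  · intro y
    obtain ⟨b, rfl⟩ := Submodule.mkQ_surjective _ y
    constructor
    · intro hb
      obtain ⟨b', rfl⟩ := (hzh b).mp hb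
      exact ⟨g b', hf b'⟩
    · rintro ⟨a, ha⟩
      obtain ⟨b', rfl⟩ := hg a
      rw [← ha, hf]
      exact hzh.apply_apply_eq_zero b'
  · intro c
    obtain ⟨b, rfl⟩ := hh c
    exact ⟨Submodule.Quotient.mk b, rfl⟩

end RegularSequences

section ExtVanishing

open CategoryTheory Abelian RingTheory.Sequence Function
open scoped Pointwise

universe u

/-- If `0 → A → B → C → 0` is exact, `Extʲ(L, B) = 0` and `Extʲ⁺¹(L, A) = 0`, then
`Extʲ(L, C) = 0`. -/
theorem ModuleCat.subsingleton_ext_of_exact {T : Type u} [CommRing T] (L : ModuleCat.{u} T)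
    {A B C : Type u} [AddCommGroup A] [AddCommGroup B] [AddCommGroup C] [Module T A]
    [Module T B] [Module T C] (f : A →ₗ[T] B) (g : B →ₗ[T] C) (hf : Injective f)
    (hfg : Exact f g) (hg : Surjective g) (j : ℕ)
    (hB : Subsingleton (Ext L (ModuleCat.of T B) j))
    (hA : Subsingleton (Ext L (ModuleCat.of T A) (j + 1))) :
    Subsingleton (Ext L (ModuleCat.of T C) j) := by
  have hS : (ModuleCat.shortComplexOfCompEqZero f g hfg.linearMap_comp_eq_zero).ShortExact :=
    { exact := ModuleCat.shortComplex_exact _ hfg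
      mono_f := by simpa [ModuleCat.mono_iff_injective] using! hf
      epi_g := by simpa [ModuleCat.epi_iff_surjective] using! hg }
  refine subsingleton_of_forall_eq 0 fun y ↦ ?_
  obtain ⟨b, rfl⟩ := Ext.covariant_sequence_exact₃ L hS y rfl
    (Subsingleton.elim (α := Ext L (ModuleCat.of T A) (j + 1)) _ _)
  rw [show b = 0 from Subsingleton.elim (α := Ext L (ModuleCat.of T B) j) _ _, Ext.zero_comp]

/-- `Ext` vanishing passes to retracts. -/
theorem ModuleCat.subsingleton_ext_of_retract {T : Type u} [CommRing T] (L : ModuleCat.{u} T)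
    {A B : Type u} [AddCommGroup A] [AddCommGroup B] [Module T A] [Module T B]
    (f : A →ₗ[T] B) (g : B →ₗ[T] A) (hgf : g ∘ₗ f = LinearMap.id) (j : ℕ)
    (hB : Subsingleton (Ext L (ModuleCat.of T B) j)) :
    Subsingleton (Ext L (ModuleCat.of T A) j) := by
  refine subsingleton_of_forall_eq 0 fun y ↦ ?_
  have h : ModuleCat.ofHom f ≫ ModuleCat.ofHom g = 𝟙 _ := by
    rw [← ModuleCat.ofHom_comp, hgf, ModuleCat.ofHom_id]
  rw [← Ext.comp_mk₀_id y, ← h, ← Ext.mk₀_comp_mk₀,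
    ← Ext.comp_assoc_of_second_deg_zero,
    show y.comp (Ext.mk₀ (ModuleCat.ofHom f)) (add_zero j) = 0 from Subsingleton.elim _ _,
    Ext.zero_comp]

/-- Let `R` be a `T`-algebra and `M` an `R`-module with an `R`-regular sequence each of whose
terms has a power in the extension to `R` of the annihilator of the `T`-module `L`. Then
`Extʲ_T(L, M) = 0` for `j` below the length of the sequence. -/
theorem ModuleCat.subsingleton_ext_of_isWeaklyRegular {T R : Type u} [CommRing T] [CommRing R]
    [Algebra T R] (L : ModuleCat.{u} T) (xs : List R)
    (hxs : ∀ x ∈ xs, x ∈ ((Module.annihilator T L).map (algebraMap T R)).radical) :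
    ∀ (M : Type u) [AddCommGroup M] [Module R M] [Module T M] [IsScalarTower T R M],
      IsWeaklyRegular M xs → ∀ j < xs.length, Subsingleton (Ext L (ModuleCat.of T M) j) := by
  induction xs with
  | nil => simp
  | cons x xs ih =>
    intro M _ _ _ _ hM j hj
    rw [isWeaklyRegular_cons_iff] at hM
    let μ : R → (ModuleCat.of T M ⟶ ModuleCat.of T M) := fun r ↦
      ModuleCat.ofHom ((LinearMap.lsmul R M r).restrictScalars T)
    have hμmul : ∀ r s, μ (r * s) = μ s ≫ μ r := fun r s ↦ by
      ext m; exact mul_smul r s m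
    have hμadd : ∀ r s, μ (r + s) = μ r + μ s := fun r s ↦ by
      ext m; exact add_smul r s m
    have hinj : ∀ e : Ext L (ModuleCat.of T M) j,
        e.comp (Ext.mk₀ (μ x)) (add_zero j) = 0 → e = 0 := by
      have hmono : Injective ((LinearMap.lsmul R M x).restrictScalars T) := hM.1
      have hex : Exact ((LinearMap.lsmul R M x).restrictScalars T)
          ((x • (⊤ : Submodule R M)).mkQ.restrictScalars T) :=
        LinearMap.exact_lsmul_mkQ_smul_top M x
      have hS : (ModuleCat.shortComplexOfCompEqZero _ _ hex.linearMap_comp_eq_zero).ShortExact :=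
        { exact := ModuleCat.shortComplex_exact _ hex
          mono_f := by simpa [ModuleCat.mono_iff_injective] using! hmono
          epi_g := by
            simpa [ModuleCat.epi_iff_surjective] using! Submodule.mkQ_surjective _ }
      intro e he
      cases j with
      | zero =>
        have : Mono (μ x) := (ModuleCat.mono_iff_injective _).mpr hmono
        exact Ext.postcomp_mk₀_injective_of_mono L (μ x) (by simpa using he)
      | succ j =>
        obtain ⟨y, rfl⟩ := Ext.covariant_sequence_exact₁ L hS e he rfl
        have := ih (fun y hy ↦ hxs y (List.mem_cons_of_mem _ hy)) (QuotSMulTop x M) hM.2 j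
          (by simpa using hj)
        rw [show y = 0 from
          Subsingleton.elim (α := Ext L (ModuleCat.of T (QuotSMulTop x M)) j) _ _, Ext.zero_comp]
    refine subsingleton_of_forall_eq 0 fun e ↦ ?_
    let I : Ideal R :=
      { carrier := {r | e.comp (Ext.mk₀ (μ r)) (add_zero j) = 0}
        add_mem' := fun {r s} hr hs ↦ by
          simp only [Set.mem_ofPred_eq] at hr hs ⊢
          rw [hμadd, Ext.mk₀_add, Ext.comp_add, hr, hs, add_zero]
        zero_mem' := by
          have : μ 0 = 0 := by ext m; exact zero_smul R m
          simp [this]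
        smul_mem' := fun r s hs ↦ by
          simp only [Set.mem_ofPred_eq] at hs ⊢
          rw [smul_eq_mul, hμmul, ← Ext.mk₀_comp_mk₀, ← Ext.comp_assoc_of_second_deg_zero, hs,
            Ext.zero_comp] }
    have hI : (Module.annihilator T L).map (algebraMap T R) ≤ I := by
      rw [Ideal.map_le_iff_le_comap]
      intro t ht
      have h1 : μ (algebraMap T R t) = t • 𝟙 _ := by
        ext m; exact algebraMap_smul R t m
      have := Ext.postcomp_smul_id_eq_zero_of_mem_annihilator
        (M := ModuleCat.of T M) ht j
      change e.comp (Ext.mk₀ (μ (algebraMap T R t))) (add_zero j) = 0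
      rw [h1]
      exact DFunLike.congr_fun (congrArg AddCommGrpCat.Hom.hom this) e
    obtain ⟨k, hxk⟩ := hxs x List.mem_cons_self
    have hk : e.comp (Ext.mk₀ (μ (x ^ k))) (add_zero j) = 0 := hI hxk
    clear hxk
    induction k with
    | zero =>
      have : μ (x ^ 0) = 𝟙 _ := by ext m; simp [μ]
      rwa [this, Ext.comp_mk₀_id] at hk
    | succ k ihk =>
      apply ihk
      apply hinj
      rw [Ext.comp_assoc_of_second_deg_zero, Ext.mk₀_comp_mk₀, ← hμmul, ← pow_succ']
      exact hk

end ExtVanishing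

section MonomialModules

open Function

variable {ι : Type} (K : Type*) [Field K]

/-- The subalgebra of polynomials all of whose exponents lie in a submonoid. -/
noncomputable def MvPolynomial.submonoidSubalgebra (Γ : AddSubmonoid (ι →₀ ℕ)) :
    Subalgebra K (MvPolynomial ι K) where
  carrier := {f | ∀ σ ∈ f.support, σ ∈ Γ}
  mul_mem' {f g} hf hg σ hσ := by
    classical
    obtain ⟨a, ha, b, hb, rfl⟩ := Finset.mem_add.mp (support_mul f g hσ)
    exact add_mem (hf a ha) (hg b hb)
  add_mem' {f g} hf hg σ hσ := by
    classical
    exact (Finset.mem_union.mp (support_add hσ)).elim (hf σ) (hg σ)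
  algebraMap_mem' r σ hσ := by
    classical
    rw [algebraMap_eq, mem_support_iff, coeff_C] at hσ
    rw [← (ite_ne_right_iff.mp hσ).1]
    exact zero_mem Γ

/-- The ring of polynomials all of whose exponents lie in a submonoid. -/
def MvPolynomial.SubmonoidRing (Γ : AddSubmonoid (ι →₀ ℕ)) : Type _ :=
  submonoidSubalgebra K Γ

noncomputable instance (Γ : AddSubmonoid (ι →₀ ℕ)) : CommRing (SubmonoidRing K Γ) :=
  inferInstanceAs (CommRing (submonoidSubalgebra K Γ))

noncomputable instance (Γ : AddSubmonoid (ι →₀ ℕ)) :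
    Algebra (SubmonoidRing K Γ) (MvPolynomial ι K) :=
  (submonoidSubalgebra K Γ).val.toRingHom.toAlgebra

variable {K}
variable {Γ : AddSubmonoid (ι →₀ ℕ)} {U V D D' J J' : SubAddAction Γ (ι →₀ ℕ)}

namespace MvPolynomial

/-- The element of `SubmonoidRing K Γ` given by a polynomial with exponents in `Γ`. -/
def SubmonoidRing.mk (f : MvPolynomial ι K) (hf : ∀ σ ∈ f.support, σ ∈ Γ) : SubmonoidRing K Γ :=
  ⟨f, hf⟩

@[simp]
theorem SubmonoidRing.algebraMap_mk (f : MvPolynomial ι K) (hf : ∀ σ ∈ f.support, σ ∈ Γ) :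
    algebraMap (SubmonoidRing K Γ) (MvPolynomial ι K) (.mk f hf) = f :=
  rfl

theorem SubmonoidRing.mem_of_mem_support (t : SubmonoidRing K Γ) {σ : ι →₀ ℕ}
    (hσ : σ ∈ (algebraMap _ (MvPolynomial ι K) t).support) : σ ∈ Γ :=
  t.2 σ hσ

variable (K) in
/-- The module of polynomials all of whose exponents lie in a set `U` of exponents which is stable
under a submonoid `Γ`. -/
noncomputable def supportModule (U : SubAddAction Γ (ι →₀ ℕ)) :
    Submodule (SubmonoidRing K Γ) (MvPolynomial ι K) where
  carrier := {f | ∀ σ ∈ f.support, σ ∈ U}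
  add_mem' {f g} hf hg σ hσ := by
    classical
    exact (Finset.mem_union.mp (support_add hσ)).elim (hf σ) (hg σ)
  zero_mem' := by simp
  smul_mem' t f hf σ hσ := by
    classical
    rw [Algebra.smul_def] at hσ
    obtain ⟨a, ha, b, hb, rfl⟩ := Finset.mem_add.mp (support_mul _ f hσ)
    exact U.vadd_mem (⟨a, t.mem_of_mem_support ha⟩ : Γ) (hf b hb)

theorem supportModule_mono (h : ∀ σ ∈ U, σ ∈ V) : supportModule K U ≤ supportModule K V :=
  fun _ hf σ hσ ↦ h σ (hf σ hσ)

theorem monomial_mul_mem_supportModule {τ : ι →₀ ℕ} {f : MvPolynomial ι K}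
    (hf : f ∈ supportModule K V) (h : ∀ σ ∈ V, τ + σ ∈ U) :
    monomial τ (1 : K) * f ∈ supportModule K U := by
  classical
  intro σ hσ
  obtain ⟨a, ha, b, hb, rfl⟩ := Finset.mem_add.mp (support_mul _ f hσ)
  rw [Finset.mem_singleton.mp (support_monomial_subset ha)]
  exact h b (hf b hb)

open Classical in
/-- Discarding the monomials of a polynomial whose exponents lie outside of a set `U` is linear
over `SubmonoidRing K Γ` if both `U` and its complement are stable under `Γ`. -/
noncomputable def supportFilter (U : SubAddAction Γ (ι →₀ ℕ))
    (hU : ∀ τ ∈ Γ, ∀ σ, τ + σ ∈ U → σ ∈ U) :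
    MvPolynomial ι K →ₗ[SubmonoidRing K Γ] MvPolynomial ι K where
  toFun f := AddMonoidAlgebra.ofCoeff ((AddMonoidAlgebra.coeff f).filter (· ∈ U))
  map_add' f g := by
    ext σ
    by_cases h : σ ∈ U <;> simp [coeff, h]
  map_smul' t f := by
    ext σ
    have key (g : MvPolynomial ι K) (σ) : coeff σ (AddMonoidAlgebra.ofCoeff
        ((AddMonoidAlgebra.coeff g).filter (· ∈ U))) = if σ ∈ U then g.coeff σ else 0 :=
      Finsupp.filter_apply _ _ _
    simp only [Algebra.smul_def, key, RingHom.id_apply, coeff_mul, mul_ite, mul_zero]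
    split_ifs with h
    · refine Finset.sum_congr rfl fun x hx ↦ ?_
      split_ifs with h'
      · rfl
      · by_cases hx' : coeff x.1 (algebraMap _ (MvPolynomial ι K) t) = 0
        · rw [hx', zero_mul]
        · exact absurd (hU _ (t.mem_of_mem_support (mem_support_iff.mpr hx')) x.2
            (by rwa [Finset.HasAntidiagonal.mem_antidiagonal.mp hx])) h'
    · refine (Finset.sum_eq_zero fun x hx ↦ ?_).symm
      split_ifs with h'
      · by_cases hx' : coeff x.1 (algebraMap _ (MvPolynomial ι K) t) = 0
        · rw [hx', zero_mul]
        · refine absurd (U.vadd_mem (⟨_, t.mem_of_mem_support (mem_support_iff.mpr hx')⟩ : Γ) h') ?_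
          rwa [← Finset.HasAntidiagonal.mem_antidiagonal.mp hx] at h
      · rfl

theorem coeff_supportFilter (hU : ∀ τ ∈ Γ, ∀ σ, τ + σ ∈ U → σ ∈ U)
    (f : MvPolynomial ι K) (σ : ι →₀ ℕ) [Decidable (σ ∈ U)] :
    (supportFilter U hU f).coeff σ = if σ ∈ U then f.coeff σ else 0 := by
  classical exact (Finsupp.filter_apply _ _ _).trans (by congr)

theorem supportFilter_mem (hU : ∀ τ ∈ Γ, ∀ σ, τ + σ ∈ U → σ ∈ U) (f : MvPolynomial ι K) :
    supportFilter U hU f ∈ supportModule K U := by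
  classical
  intro σ hσ
  rw [mem_support_iff, coeff_supportFilter] at hσ
  exact (ite_ne_right_iff.mp hσ).1

theorem supportFilter_eq_self (hU : ∀ τ ∈ Γ, ∀ σ, τ + σ ∈ U → σ ∈ U) {f : MvPolynomial ι K}
    (hf : f ∈ supportModule K U) : supportFilter U hU f = f := by
  classical
  ext σ
  rw [coeff_supportFilter, ite_eq_left_iff]
  intro hσ
  by_contra h
  exact hσ (hf σ (mem_support_iff.mpr (Ne.symm h)))

theorem supportFilter_eq_zero_iff (hU : ∀ τ ∈ Γ, ∀ σ, τ + σ ∈ U → σ ∈ U) {f : MvPolynomial ι K} :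
    supportFilter U hU f = 0 ↔ ∀ σ ∈ f.support, σ ∉ U := by
  classical
  simp only [MvPolynomial.ext_iff, coeff_supportFilter, coeff_zero, ite_eq_right_iff,
    mem_support_iff]
  grind

/-- The subquotient of the polynomial ring spanned by the monomials with exponents in
`D \ J`. -/
abbrev Subquotient (K : Type*) [Field K] (D J : SubAddAction Γ (ι →₀ ℕ)) : Type _ :=
  supportModule K D ⧸ (supportModule K J).submoduleOf (supportModule K D)

namespace Subquotient

/-- Multiplication by a monomial on subquotients. -/
noncomputable def mulMonomial (τ : ι →₀ ℕ) (hD : ∀ σ ∈ D', τ + σ ∈ D) (hJ : ∀ σ ∈ J, τ + σ ∈ J) :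
    Subquotient K D' J →ₗ[SubmonoidRing K Γ] Subquotient K D J :=
  Submodule.mapQ _ _ ((LinearMap.mulLeft (SubmonoidRing K Γ) (monomial τ (1 : K))).restrict
    fun _ hf ↦ monomial_mul_mem_supportModule hf hD)
    fun _ hf ↦ monomial_mul_mem_supportModule hf hJ

/-- The projection between subquotients. -/
noncomputable def proj (hJ : ∀ σ ∈ J, σ ∈ J') :
    Subquotient K D J →ₗ[SubmonoidRing K Γ] Subquotient K D J' :=
  Submodule.mapQ _ _ LinearMap.id fun _ hf ↦ supportModule_mono hJ hf

theorem proj_surjective (hJ : ∀ σ ∈ J, σ ∈ J') :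
    Surjective (proj (K := K) (D := D) hJ) :=
  fun x ↦ (Submodule.Quotient.mk_surjective _ x).elim fun f hf ↦ ⟨Submodule.Quotient.mk f, hf⟩

theorem proj_mk_eq_zero_iff (hJ : ∀ σ ∈ J, σ ∈ J') (f : supportModule K D) :
    proj hJ (Submodule.Quotient.mk f : Subquotient K D J) = 0 ↔ f.1 ∈ supportModule K J' :=
  Submodule.Quotient.mk_eq_zero _

theorem mk_eq_zero_iff (f : supportModule K D) :
    (Submodule.Quotient.mk f : Subquotient K D J) = 0 ↔ f.1 ∈ supportModule K J :=
  Submodule.Quotient.mk_eq_zero _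

theorem mulMonomial_mk_eq_zero_iff {τ : ι →₀ ℕ} {hD : ∀ σ ∈ D', τ + σ ∈ D}
    {hJ : ∀ σ ∈ J, τ + σ ∈ J} (f : supportModule K D') :
    mulMonomial τ hD hJ (Submodule.Quotient.mk f) = 0 ↔
      monomial τ (1 : K) * f.1 ∈ supportModule K J :=
  Submodule.Quotient.mk_eq_zero _

theorem mulMonomial_injective {τ : ι →₀ ℕ} {hD : ∀ σ ∈ D', τ + σ ∈ D}
    {hJ : ∀ σ ∈ J, τ + σ ∈ J} (h : ∀ σ ∈ D', τ + σ ∈ J → σ ∈ J) :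
    Injective (mulMonomial (K := K) τ hD hJ) := by
  rw [← LinearMap.ker_eq_bot, LinearMap.ker_eq_bot']
  intro x hx
  obtain ⟨f, rfl⟩ := Submodule.Quotient.mk_surjective _ x
  rw [mk_eq_zero_iff]
  have hf : monomial τ (1 : K) * f.1 ∈ supportModule K J := (mulMonomial_mk_eq_zero_iff _).mp hx
  intro σ hσ
  refine h σ (f.2 σ hσ) (hf _ ?_)
  rwa [mem_support_iff, coeff_monomial_mul, one_mul, ← mem_support_iff]

theorem exact_mulMonomial_proj {τ : ι →₀ ℕ} {hD : ∀ σ ∈ D', τ + σ ∈ D}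
    {hJ : ∀ σ ∈ J, τ + σ ∈ J} {hJJ' : ∀ σ ∈ J, σ ∈ J'} (h : ∀ σ, τ + σ ∈ D → σ ∈ D')
    (h₁ : ∀ σ, τ + σ ∈ J') (h₂ : ∀ σ ∈ J', σ ∈ J ∨ τ ≤ σ) :
    Exact (mulMonomial (K := K) τ hD hJ) (proj hJJ') := by
  intro x
  obtain ⟨f, rfl⟩ := Submodule.Quotient.mk_surjective _ x
  constructor
  · intro hf
    replace hf : f.1 ∈ supportModule K J' := (proj_mk_eq_zero_iff _ _).mp hf
    refine ⟨Submodule.Quotient.mk ⟨f.1.divMonomial τ, fun σ hσ ↦ ?_⟩, ?_⟩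
    · rw [mem_support_iff, coeff_divMonomial] at hσ
      exact h σ (f.2 _ (mem_support_iff.mpr hσ))
    · refine (Submodule.Quotient.eq _).mpr ?_
      change monomial τ (1 : K) * (f.1.divMonomial τ) - f.1 ∈ supportModule K J
      intro σ hσ
      rw [mem_support_iff, coeff_sub] at hσ
      by_cases hτ : τ ≤ σ
      · obtain ⟨σ, rfl⟩ := exists_add_of_le hτ
        simp at hσ
      · rw [coeff_monomial_mul', if_neg hτ, zero_sub, neg_ne_zero, ← mem_support_iff] at hσ
        exact (h₂ σ (hf σ hσ)).resolve_right hτ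
  · rintro ⟨y, hy⟩
    obtain ⟨g, rfl⟩ := Submodule.Quotient.mk_surjective _ y
    rw [← hy]
    refine (Submodule.Quotient.mk_eq_zero _).mpr
      (monomial_mul_mem_supportModule g.2 fun σ _ ↦ h₁ σ)

end Subquotient

end MvPolynomial

end MonomialModules

namespace VeroneseSegre

open Function Finsupp

variable (K : Type*) [Field K] (m n c d : ℕ)

/-- The degree `d|α| - c|β|` of the monomial `X^αY^β`. -/
def degree (σ : (Fin m ⊕ Fin n) →₀ ℕ) : ℤ :=
  (d : ℤ) * xsum m n σ - (c : ℤ) * ysum m n σ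

/-- The level `∑ ⌊αₐ/c⌋ - ∑ ⌊β_b/d⌋` of the monomial `X^αY^β`. -/
def level (σ : (Fin m ⊕ Fin n) →₀ ℕ) : ℤ :=
  ∑ a : Fin m, ((σ (Sum.inl a) / c : ℕ) : ℤ) - ∑ b : Fin n, ((σ (Sum.inr b) / d : ℕ) : ℤ)

variable {m n c d}

theorem degree_add (τ σ : (Fin m ⊕ Fin n) →₀ ℕ) :
    degree m n c d (τ + σ) = degree m n c d τ + degree m n c d σ := by
  simp only [degree, xsum, ysum, Finsupp.add_apply, Nat.cast_add, Finset.sum_add_distrib]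
  ring

theorem level_add {τ : (Fin m ⊕ Fin n) →₀ ℕ} (h₁ : ∀ a, c ∣ τ (Sum.inl a))
    (h₂ : ∀ b, d ∣ τ (Sum.inr b)) (σ : (Fin m ⊕ Fin n) →₀ ℕ) :
    level m n c d (τ + σ) = level m n c d τ + level m n c d σ := by
  simp only [level, Finsupp.add_apply, Nat.add_div_of_dvd_right (h₁ _),
    Nat.add_div_of_dvd_right (h₂ _), Nat.cast_add, Finset.sum_add_distrib]
  ring

theorem degree_single_inl (a : Fin m) :
    degree m n c d (single (Sum.inl a) c) = c * d := by
  simp [degree, xsum, ysum, Finsupp.single_apply, mul_comm]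

theorem degree_single_inr (b : Fin n) :
    degree m n c d (single (Sum.inr b) d) = -(c * d) := by
  simp [degree, xsum, ysum, Finsupp.single_apply]

theorem level_single_inl (hc : 0 < c) (a : Fin m) :
    level m n c d (single (Sum.inl a) c) = 1 := by
  simp [level, Finsupp.single_apply, apply_ite (· / c), Nat.div_self hc]

theorem level_single_inr (hd : 0 < d) (b : Fin n) :
    level m n c d (single (Sum.inr b) d) = -1 := by
  simp [level, Finsupp.single_apply, apply_ite (· / d), Nat.div_self hd]

theorem degree_single_inl_add (a : Fin m) (σ : (Fin m ⊕ Fin n) →₀ ℕ) :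
    degree m n c d (single (Sum.inl a) c + σ) = degree m n c d σ + c * d := by
  rw [degree_add, degree_single_inl, add_comm]

theorem degree_single_inr_add (b : Fin n) (σ : (Fin m ⊕ Fin n) →₀ ℕ) :
    degree m n c d (single (Sum.inr b) d + σ) = degree m n c d σ - c * d := by
  rw [degree_add, degree_single_inr]; ring

theorem level_single_inl_add (hc : 0 < c) (a : Fin m) (σ : (Fin m ⊕ Fin n) →₀ ℕ) :
    level m n c d (single (Sum.inl a) c + σ) = level m n c d σ + 1 := by
  rw [level_add, level_single_inl hc, add_comm]
  · intro a'
    by_cases h : a = a' <;> simp [h]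
  · simp

theorem level_single_inr_add (hd : 0 < d) (b : Fin n) (σ : (Fin m ⊕ Fin n) →₀ ℕ) :
    level m n c d (single (Sum.inr b) d + σ) = level m n c d σ - 1 := by
  rw [level_add, level_single_inr hd]
  · ring
  · simp
  · intro a'
    by_cases h : b = a' <;> simp [h]

variable (m n c d) in
/-- The exponents of the monomials of degree zero and level zero in the `Xₐ^c` and `Y_b^d`. -/
def grid : AddSubmonoid ((Fin m ⊕ Fin n) →₀ ℕ) where
  carrier := {τ | (∀ a, c ∣ τ (Sum.inl a)) ∧ (∀ b, d ∣ τ (Sum.inr b)) ∧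
    degree m n c d τ = 0 ∧ level m n c d τ = 0}
  add_mem' {τ σ} := fun ⟨h₁, h₂, h₃, h₄⟩ ⟨h₁', h₂', h₃', h₄'⟩ ↦
    ⟨fun a ↦ dvd_add (h₁ a) (h₁' a), fun b ↦ dvd_add (h₂ b) (h₂' b),
      by rw [degree_add, h₃, h₃', add_zero], by rw [level_add h₁ h₂, h₄, h₄', add_zero]⟩
  zero_mem' := by simp [degree, level, xsum, ysum]

variable (m n c d) in
/-- The exponents of degree `i` whose level lies in `s`. -/
def cell (i : ℤ) (s : Set ℤ) : SubAddAction (grid m n c d) ((Fin m ⊕ Fin n) →₀ ℕ) where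
  carrier := {σ | degree m n c d σ = i ∧ level m n c d σ ∈ s}
  vadd_mem' τ σ hσ := by
    obtain ⟨τ, h₁, h₂, h₃, h₄⟩ := τ
    change degree m n c d (τ + σ) = i ∧ level m n c d (τ + σ) ∈ s
    rw [degree_add, level_add h₁ h₂, h₃, h₄, zero_add, zero_add]
    exact hσ

theorem mem_cell {i : ℤ} {s : Set ℤ} {σ : (Fin m ⊕ Fin n) →₀ ℕ} :
    σ ∈ cell m n c d i s ↔ degree m n c d σ = i ∧ level m n c d σ ∈ s :=
  .rfl

theorem mem_cell_of_add_mem {i : ℤ} {s : Set ℤ} (τ) (hτ : τ ∈ grid m n c d)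
    (σ : (Fin m ⊕ Fin n) →₀ ℕ) (h : τ + σ ∈ cell m n c d i s) : σ ∈ cell m n c d i s := by
  obtain ⟨h₁, h₂, h₃, h₄⟩ := hτ
  rwa [mem_cell, degree_add, level_add h₁ h₂, h₃, h₄, zero_add, zero_add] at h

variable (m n c d) in
/-- The exponents of the monomials in the ideal generated by `Xₐ^c` for `a ≥ p` and `Y_b^d` for
`b ≥ q`. -/
def powersFrom (p q : ℕ) : SubAddAction (grid m n c d) ((Fin m ⊕ Fin n) →₀ ℕ) where
  carrier := {σ | (∃ a : Fin m, p ≤ a ∧ c ≤ σ (Sum.inl a)) ∨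
    ∃ b : Fin n, q ≤ b ∧ d ≤ σ (Sum.inr b)}
  vadd_mem' τ σ hσ := by
    rcases hσ with ⟨a, h₁, h₂⟩ | ⟨b, h₁, h₂⟩
    · exact .inl ⟨a, h₁, h₂.trans (Nat.le_add_left _ _)⟩
    · exact .inr ⟨b, h₁, h₂.trans (Nat.le_add_left _ _)⟩

theorem add_mem_powersFrom {p q : ℕ} (τ : (Fin m ⊕ Fin n) →₀ ℕ) (σ)
    (hσ : σ ∈ powersFrom m n c d p q) : τ + σ ∈ powersFrom m n c d p q := by
  rcases hσ with ⟨a, h₁, h₂⟩ | ⟨b, h₁, h₂⟩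
  · exact .inl ⟨a, h₁, h₂.trans (Nat.le_add_left _ _)⟩
  · exact .inr ⟨b, h₁, h₂.trans (Nat.le_add_left _ _)⟩

theorem powersFrom_anti {p q p' q' : ℕ} (hp : p' ≤ p) (hq : q' ≤ q) (σ)
    (hσ : σ ∈ powersFrom m n c d p q) : σ ∈ powersFrom m n c d p' q' :=
  hσ.imp (fun ⟨a, h₁, h₂⟩ ↦ ⟨a, hp.trans h₁, h₂⟩) (fun ⟨b, h₁, h₂⟩ ↦ ⟨b, hq.trans h₁, h₂⟩)

variable (m n c d) in
/-- The quotient of the module of polynomials of degree `i` and level `δ` by the ideal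
generated by `Xₐ^c` for `a ≥ p` and `Y_b^d` for `b ≥ q`. -/
abbrev Piece (p q : ℕ) (i δ : ℤ) : Type _ :=
  Subquotient K (cell m n c d i {δ}) (powersFrom m n c d p q)

variable {K}

/-- Multiplication by `X_p^c`. -/
noncomputable def mulX (hc : 0 < c) (p : Fin m) (q : ℕ) {i i' δ δ' : ℤ} (hi : i' = i + c * d)
    (hδ : δ' = δ + 1) :
    Piece K m n c d (p + 1) q i δ →ₗ[SubmonoidRing K (grid m n c d)]
      Piece K m n c d (p + 1) q i' δ' :=
  Subquotient.mulMonomial (single (Sum.inl p) c)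
    (fun σ hσ ↦ by
      rwa [mem_cell, degree_single_inl_add, level_single_inl_add hc, hi, hδ, add_left_inj,
        Set.mem_singleton_iff, add_left_inj])
    (add_mem_powersFrom _)

/-- Multiplication by `Y_q^d`. -/
noncomputable def mulY (hd : 0 < d) (p : ℕ) (q : Fin n) {i i' δ δ' : ℤ} (hi : i' = i - c * d)
    (hδ : δ' = δ - 1) :
    Piece K m n c d p (q + 1) i δ →ₗ[SubmonoidRing K (grid m n c d)]
      Piece K m n c d p (q + 1) i' δ' :=
  Subquotient.mulMonomial (single (Sum.inr q) d)
    (fun σ hσ ↦ by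
      rwa [mem_cell, degree_single_inr_add, level_single_inr_add hd, hi, hδ, sub_left_inj,
        Set.mem_singleton_iff, sub_left_inj])
    (add_mem_powersFrom _)

theorem mulX_injective (hc : 0 < c) (p : Fin m) (q : ℕ) {i i' δ δ' : ℤ} (hi : i' = i + c * d)
    (hδ : δ' = δ + 1) : Injective (mulX (K := K) (n := n) (d := d) hc p q hi hδ) := by
  refine Subquotient.mulMonomial_injective fun σ _ hσ ↦ ?_
  rcases hσ with ⟨a, h₁, h₂⟩ | ⟨b, h₁, h₂⟩
  · refine .inl ⟨a, h₁, ?_⟩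
    rwa [Finsupp.add_apply, Finsupp.single_eq_of_ne, zero_add] at h₂
    rintro h
    have := Sum.inl_injective h
    omega
  · exact .inr ⟨b, h₁, by simpa using h₂⟩

theorem mulY_injective (hd : 0 < d) (p : ℕ) (q : Fin n) {i i' δ δ' : ℤ} (hi : i' = i - c * d)
    (hδ : δ' = δ - 1) : Injective (mulY (K := K) (m := m) hd p q hi hδ) := by
  refine Subquotient.mulMonomial_injective fun σ _ hσ ↦ ?_
  rcases hσ with ⟨a, h₁, h₂⟩ | ⟨b, h₁, h₂⟩
  · exact .inl ⟨a, h₁, by simpa using h₂⟩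
  · refine .inr ⟨b, h₁, ?_⟩
    rwa [Finsupp.add_apply, Finsupp.single_eq_of_ne, zero_add] at h₂
    rintro h
    have := Sum.inr_injective h
    omega

theorem exact_mulX_proj (hc : 0 < c) (p : Fin m) (q : ℕ) {i i' δ δ' : ℤ} (hi : i' = i + c * d)
    (hδ : δ' = δ + 1) : Exact (mulX (K := K) (n := n) (d := d) hc p q hi hδ)
      (Subquotient.proj (powersFrom_anti p.1.le_succ le_rfl)) := by
  refine Subquotient.exact_mulMonomial_proj (fun σ hσ ↦ ?_) (fun σ ↦ ?_) (fun σ hσ ↦ ?_)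
  · rwa [mem_cell, degree_single_inl_add, level_single_inl_add hc, hi, hδ, add_left_inj,
      Set.mem_singleton_iff, add_left_inj] at hσ
  · exact .inl ⟨p, le_rfl, by simp⟩
  · rcases hσ with ⟨a, h₁, h₂⟩ | h
    · rcases h₁.lt_or_eq with h₃ | h₃
      · exact .inl (.inl ⟨a, h₃, h₂⟩)
      · right
        rwa [Finsupp.single_le_iff, Fin.ext h₃]
    · exact .inl (.inr h)

theorem exact_mulY_proj (hd : 0 < d) (p : ℕ) (q : Fin n) {i i' δ δ' : ℤ} (hi : i' = i - c * d)
    (hδ : δ' = δ - 1) : Exact (mulY (K := K) (m := m) hd p q hi hδ)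
      (Subquotient.proj (powersFrom_anti le_rfl q.1.le_succ)) := by
  refine Subquotient.exact_mulMonomial_proj (fun σ hσ ↦ ?_) (fun σ ↦ ?_) (fun σ hσ ↦ ?_)
  · rwa [mem_cell, degree_single_inr_add, level_single_inr_add hd, hi, hδ, sub_left_inj,
      Set.mem_singleton_iff, sub_left_inj] at hσ
  · exact .inr ⟨q, le_rfl, by simp⟩
  · rcases hσ with h | ⟨b, h₁, h₂⟩
    · exact .inl (.inl h)
    · rcases h₁.lt_or_eq with h₃ | h₃
      · exact .inl (.inr ⟨b, h₃, h₂⟩)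
      · right
        rwa [Finsupp.single_le_iff, Fin.ext h₃]

theorem single_add_single_mem_grid (hc : 0 < c) (hd : 0 < d) (a : Fin m) (b : Fin n) :
    single (Sum.inl a) c + single (Sum.inr b) d ∈ grid m n c d := by
  refine ⟨fun a' ↦ ?_, fun b' ↦ ?_, ?_, ?_⟩
  · by_cases h : a = a' <;> simp [h]
  · by_cases h : b = b' <;> simp [h]
  · rw [degree_single_inl_add, degree_single_inr]; ring
  · rw [level_single_inl_add hc, level_single_inr hd]; ring

variable (K m n) in
/-- The element `∑ Xₐ^c Y_b^d`, summed over `a + b = k`. -/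
noncomputable def theta (hc : 0 < c) (hd : 0 < d) (k : ℕ) : SubmonoidRing K (grid m n c d) :=
  .mk (∑ x : Fin m × Fin n with x.1 + x.2 = k,
      monomial (single (Sum.inl x.1) c + single (Sum.inr x.2) d) 1) fun σ hσ ↦ by
    classical
    obtain ⟨x, -, hx⟩ := Finset.mem_biUnion.mp (support_sum hσ)
    rw [Finset.mem_singleton.mp (support_monomial_subset hx)]
    exact single_add_single_mem_grid hc hd _ _

theorem monomial_mul_sub_theta_smul_mem (hc : 0 < c) (hd : 0 < d) (p : Fin m) (q : Fin n)
    (f : MvPolynomial (Fin m ⊕ Fin n) K) :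
    monomial (single (Sum.inl p) c + single (Sum.inr q) d) 1 * f -
      theta K m n hc hd (p + q) • f ∈ supportModule K (powersFrom m n c d (p + 1) (q + 1)) := by
  classical
  rw [← Submodule.neg_mem_iff, neg_sub, Algebra.smul_def, theta, SubmonoidRing.algebraMap_mk,
    ← sub_mul, ← Finset.sum_erase_eq_sub (a := (p, q)) (by simp), Finset.sum_mul]
  refine Submodule.sum_mem _ fun x hx ↦ ?_
  obtain ⟨x, y⟩ := x
  simp only [Finset.mem_erase, ne_eq, Prod.mk.injEq, Finset.mem_filter, Finset.mem_univ, true_and,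
    Fin.ext_iff] at hx
  refine monomial_mul_mem_supportModule (V := ⊤) (fun _ _ ↦ trivial) fun σ _ ↦ ?_
  by_cases h : p + 1 ≤ x.1
  · exact .inl ⟨x, h, by simp [add_assoc]⟩
  · exact .inr ⟨y, by omega, by simp [add_comm]⟩

theorem mulX_mulY (hc : 0 < c) (hd : 0 < d) (p : Fin m) (q : Fin n) {i i' δ δ' : ℤ}
    (hi : i = i' + c * d) (hi' : i' = i - c * d) (hδ : δ = δ' + 1) (hδ' : δ' = δ - 1)
    (x : Piece K m n c d (p + 1) (q + 1) i δ) :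
    mulX hc p (q + 1) hi hδ (mulY hd (p + 1) q hi' hδ' x) = theta K m n hc hd (p + q) • x := by
  obtain ⟨f, rfl⟩ := Submodule.Quotient.mk_surjective _ x
  refine (Submodule.Quotient.eq _).mpr ?_
  have := monomial_mul_sub_theta_smul_mem hc hd p q f.1
  rwa [← one_mul (1 : K), ← monomial_mul, mul_assoc] at this

theorem mulY_mulX (hc : 0 < c) (hd : 0 < d) (p : Fin m) (q : Fin n) {i i' δ δ' : ℤ}
    (hi : i = i' - c * d) (hi' : i' = i + c * d) (hδ : δ = δ' - 1) (hδ' : δ' = δ + 1)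
    (x : Piece K m n c d (p + 1) (q + 1) i δ) :
    mulY hd (p + 1) q hi hδ (mulX hc p (q + 1) hi' hδ' x) = theta K m n hc hd (p + q) • x := by
  obtain ⟨f, rfl⟩ := Submodule.Quotient.mk_surjective _ x
  refine (Submodule.Quotient.eq _).mpr ?_
  have := monomial_mul_sub_theta_smul_mem hc hd p q f.1
  rwa [add_comm (single _ _), ← one_mul (1 : K), ← monomial_mul, mul_assoc] at this

end VeroneseSegre

namespace VeroneseSegre

open Function Finsupp

variable {K : Type*} [Field K] {m n c d : ℕ}

variable (K m n) in
/-- The list `θ_{k-1}, θ_{k-2}, …` with `j ≤ k` terms. -/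
noncomputable def thetas (hc : 0 < c) (hd : 0 < d) :
    ℕ → ℕ → List (SubmonoidRing K (grid m n c d))
  | _, 0 => []
  | 0, _ + 1 => []
  | k + 1, j + 1 => theta K m n hc hd k :: thetas hc hd k j

theorem length_thetas (hc : 0 < c) (hd : 0 < d) {k j : ℕ} (h : j ≤ k) :
    (thetas K m n hc hd k j).length = j := by
  induction k generalizing j with
  | zero => rw [Nat.le_zero.mp h]; rfl
  | succ k ih =>
    cases j with
    | zero => rfl
    | succ j => exact congrArg (· + 1) (ih (by omega))

theorem mem_thetas (hc : 0 < c) (hd : 0 < d) {k j : ℕ} {t : SubmonoidRing K (grid m n c d)}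
    (h : t ∈ thetas K m n hc hd k j) : ∃ l, t = theta K m n hc hd l := by
  induction k generalizing j with
  | zero => cases j <;> simp [thetas] at h
  | succ k ih =>
    cases j with
    | zero => simp [thetas] at h
    | succ j => exact (List.mem_cons.mp h).elim (fun h ↦ ⟨k, h⟩) ih

theorem _root_.RingTheory.Sequence.IsWeaklyRegular.of_subsingleton {R M : Type*} [CommRing R]
    [AddCommGroup M] [Module R M] [Subsingleton M] (rs : List R) :
    RingTheory.Sequence.IsWeaklyRegular M rs := by
  exact ⟨fun i hi x y _ ↦ Subsingleton.elim _ _⟩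

theorem subsingleton_piece_of_forall {p q : ℕ} {i δ : ℤ}
    (h : ∀ σ : (Fin m ⊕ Fin n) →₀ ℕ, level m n c d σ = δ → σ ∈ powersFrom m n c d p q) :
    Subsingleton (Piece K m n c d p q i δ) :=
  Submodule.Quotient.subsingleton_iff.mpr <|
    eq_top_iff.mpr fun f _ σ hσ ↦ h σ (f.2 σ hσ).2

theorem subsingleton_piece_zero_left {q : ℕ} {i δ : ℤ} (hδ : 0 < δ) :
    Subsingleton (Piece K m n c d 0 q i δ) := by
  refine subsingleton_piece_of_forall fun σ hσ ↦ ?_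
  by_contra h
  have h₀ : ∀ a : Fin m, σ (Sum.inl a) / c = 0 := fun a ↦
    Nat.div_eq_of_lt (not_le.mp fun h' ↦ h (.inl ⟨a, Nat.zero_le _, h'⟩))
  have : 0 ≤ ∑ b : Fin n, ((σ (Sum.inr b) / d : ℕ) : ℤ) :=
    Finset.sum_nonneg fun _ _ ↦ Nat.cast_nonneg _
  simp only [level, h₀, Nat.cast_zero, Finset.sum_const_zero] at hσ
  omega

theorem subsingleton_piece_zero_right {p : ℕ} {i δ : ℤ} (hδ : δ < 0) :
    Subsingleton (Piece K m n c d p 0 i δ) := by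
  refine subsingleton_piece_of_forall fun σ hσ ↦ ?_
  by_contra h
  have h₀ : ∀ b : Fin n, σ (Sum.inr b) / d = 0 := fun b ↦
    Nat.div_eq_of_lt (not_le.mp fun h' ↦ h (.inr ⟨b, Nat.zero_le _, h'⟩))
  have : 0 ≤ ∑ a : Fin m, ((σ (Sum.inl a) / c : ℕ) : ℤ) :=
    Finset.sum_nonneg fun _ _ ↦ Nat.cast_nonneg _
  simp only [level, h₀, Nat.cast_zero, Finset.sum_const_zero] at hσ
  omega

open RingTheory.Sequence in
theorem isWeaklyRegular_piece_cons_of_sub (hc : 0 < c) (hd : 0 < d) (p : Fin m) (q : Fin n)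
    (i δ : ℤ) {L : List (SubmonoidRing K (grid m n c d))}
    (hA : IsWeaklyRegular (Piece K m n c d (p + 1) q (i - c * d) (δ - 1)) L)
    (hC : IsWeaklyRegular (Piece K m n c d p (q + 1) i δ) L) :
    IsWeaklyRegular (Piece K m n c d (p + 1) (q + 1) i δ) (theta K m n hc hd (p + q) :: L) :=
  .cons_of_factorization (mulY_injective hd (p + 1) q rfl rfl)
    (mulX_injective hc p (q + 1) (sub_add_cancel _ _).symm (sub_add_cancel _ _).symm)
    (exact_mulY_proj hd _ _ _ _) (Subquotient.proj_surjective _)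
    (exact_mulX_proj hc _ _ _ _) (Subquotient.proj_surjective _)
    (mulX_mulY hc hd _ _ _ _ _ _) hA hC

open RingTheory.Sequence in
theorem isWeaklyRegular_piece_cons_of_add (hc : 0 < c) (hd : 0 < d) (p : Fin m) (q : Fin n)
    (i δ : ℤ) {L : List (SubmonoidRing K (grid m n c d))}
    (hA : IsWeaklyRegular (Piece K m n c d p (q + 1) (i + c * d) (δ + 1)) L)
    (hC : IsWeaklyRegular (Piece K m n c d (p + 1) q i δ) L) :
    IsWeaklyRegular (Piece K m n c d (p + 1) (q + 1) i δ) (theta K m n hc hd (p + q) :: L) :=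
  .cons_of_factorization (mulX_injective hc p (q + 1) rfl rfl)
    (mulY_injective hd (p + 1) q (add_sub_cancel_right _ _).symm (add_sub_cancel_right _ _).symm)
    (exact_mulX_proj hc _ _ _ _) (Subquotient.proj_surjective _)
    (exact_mulY_proj hd _ _ _ _) (Subquotient.proj_surjective _)
    (mulY_mulX hc hd _ _ _ _ _ _) hA hC

theorem isWeaklyRegular_piece (hc : 0 < c) (hd : 0 < d) {p q : ℕ} (hp : p ≤ m) (hq : q ≤ n)
    (i δ : ℤ) (j : ℕ) (hj : j = 0 ∨ j + 1 ≤ p + q) (h₁ : δ < q ∨ j ≤ q)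
    (h₂ : -(p : ℤ) < δ ∨ j ≤ p) :
    RingTheory.Sequence.IsWeaklyRegular (Piece K m n c d p q i δ)
      (thetas K m n hc hd (p + q - 1) j) := by
  induction hs : p + q generalizing p q i δ j with
  | zero =>
    obtain rfl : j = 0 := by omega
    exact .nil _ _
  | succ s ih =>
    cases j with
    | zero =>
      rw [thetas]
      exact .nil _ _
    | succ j =>
      cases p with
      | zero =>
        have := subsingleton_piece_zero_left (K := K) (m := m) (n := n) (c := c) (d := d) (q := q)
          (i := i) (δ := δ) (by omega)
        exact .of_subsingleton _
      | succ p =>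
        cases q with
        | zero =>
          have := subsingleton_piece_zero_right (K := K) (m := m) (n := n) (c := c) (d := d)
            (p := p + 1) (i := i) (δ := δ) (by omega)
          exact .of_subsingleton _
        | succ q =>
          obtain rfl : s = (p + q) + 1 := by omega
          rw [Nat.add_sub_cancel, thetas]
          push_cast at h₁ h₂
          by_cases h₃ : -(p : ℤ) < δ ∨ j ≤ p
          · refine isWeaklyRegular_piece_cons_of_sub hc hd ⟨p, hp⟩ ⟨q, hq⟩ i δ ?_ ?_
            · exact ih hp (Nat.le_of_succ_le hq) _ _ j (by omega) (by omega) (by omega) (by omega)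
            · exact ih (Nat.le_of_succ_le hp) hq _ _ j (by omega) (by omega) (by omega) (by omega)
          · refine isWeaklyRegular_piece_cons_of_add hc hd ⟨p, hp⟩ ⟨q, hq⟩ i δ ?_ ?_
            · exact ih (Nat.le_of_succ_le hp) hq _ _ j (by omega) (by omega) (by omega) (by omega)
            · exact ih hp (Nat.le_of_succ_le hq) _ _ j (by omega) (by omega) (by omega) (by omega)

end VeroneseSegre

namespace VeroneseSegre

theorem ceil_sub_div_add_ceil_div_nonpos_iff {c d : ℕ} (hc : 0 < c) (hd : 0 < d) (m x y : ℤ) :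
    ⌈((m : ℚ) - x) / c⌉ + ⌈(y : ℚ) / d⌉ ≤ 0 ↔ ∃ k : ℤ, c * k - x ≤ -m ∧ 0 ≤ d * k - y := by
  have hc' : (0 : ℚ) < c := by exact_mod_cast hc
  have hd' : (0 : ℚ) < d := by exact_mod_cast hd
  have h₁ (k : ℤ) : ⌈((m : ℚ) - x) / c⌉ ≤ -k ↔ c * k - x ≤ -m := by
    rw [Int.ceil_le, div_le_iff₀ hc', ← @Int.cast_le ℚ]
    push_cast
    constructor <;> intro h <;> linarith
  have h₂ (k : ℤ) : ⌈(y : ℚ) / d⌉ ≤ k ↔ 0 ≤ d * k - y := by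
    rw [Int.ceil_le, div_le_iff₀ hd', ← @Int.cast_le ℚ]
    push_cast
    constructor <;> intro h <;> linarith
  simp only [← h₁, ← h₂]
  exact ⟨fun h ↦ ⟨_, by omega, le_rfl⟩, fun ⟨k, h, h'⟩ ↦ by omega⟩

theorem exists_level_le_neg_iff {m n c d : ℕ} (hm : 0 < m) (hn : 0 < n) (hc : 0 < c) (hd : 0 < d)
    {u v : ℤ} (huv : c * u - d * v = 1) (i : ℤ) :
    (∃ (α : Fin m → ℕ) (β : Fin n → ℕ),
      (d : ℤ) * ∑ a, (α a : ℤ) - (c : ℤ) * ∑ b, (β b : ℤ) = i ∧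
        ∑ a, ((α a / c : ℕ) : ℤ) - ∑ b, ((β b / d : ℕ) : ℤ) ≤ -m) ↔
      ∃ k : ℤ, c * k - v * i ≤ -m ∧ 0 ≤ d * k - u * i := by
  constructor
  · rintro ⟨α, β, h₁, h₂⟩
    set A := ∑ a, (α a : ℤ)
    set B := ∑ b, (β b : ℤ)
    set Z := ∑ a, ((α a / c : ℕ) : ℤ)
    set W := ∑ b, ((β b / d : ℕ) : ℤ)
    have hcop : IsCoprime (c : ℤ) d := ⟨u, -v, by linarith⟩
    have hdvd : (c : ℤ) ∣ A + v * i := by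
      have : (c : ℤ) ∣ d * (A + v * i) := ⟨B + u * i, by linear_combination h₁ - i * huv⟩
      exact hcop.dvd_of_dvd_mul_left this
    obtain ⟨k, hk⟩ := hdvd
    have hc' : (0 : ℤ) < c := by exact_mod_cast hc
    have hB : B + u * i = d * k := by
      apply mul_left_cancel₀ hc'.ne'
      linear_combination d * hk - h₁ + i * huv
    have hA : A ≤ c * Z + m * (c - 1) := by
      have : ∀ a, (α a : ℤ) ≤ c * ((α a / c : ℕ) : ℤ) + (c - 1) := fun a ↦ by
        have h := Nat.div_add_mod (α a) c
        have h' := Nat.mod_lt (α a) hc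
        zify at h h'
        push_cast
        linarith
      calc A ≤ ∑ a : Fin m, (c * ((α a / c : ℕ) : ℤ) + (c - 1)) :=
            Finset.sum_le_sum fun a _ ↦ this a
        _ = _ := by
            rw [Finset.sum_add_distrib, ← Finset.mul_sum, Finset.sum_const, Finset.card_univ,
              Fintype.card_fin, nsmul_eq_mul]
    have hW : d * W ≤ B := by
      rw [Finset.mul_sum]
      refine Finset.sum_le_sum fun b _ ↦ ?_
      exact_mod_cast Nat.mul_div_le (β b) d
    refine ⟨k - W, ?_, ?_⟩
    · nlinarith
    · linarith
  · rintro ⟨k, h₁, h₂⟩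
    obtain ⟨t, ht⟩ := Int.eq_ofNat_of_zero_le (a := -m - (c * k - v * i)) (by linarith)
    obtain ⟨g, hg⟩ := Int.eq_ofNat_of_zero_le h₂
    obtain ⟨m, rfl⟩ := Nat.exists_eq_succ_of_ne_zero hm.ne'
    obtain ⟨n, rfl⟩ := Nat.exists_eq_succ_of_ne_zero hn.ne'
    obtain ⟨c, rfl⟩ := Nat.exists_eq_succ_of_ne_zero hc.ne'
    refine ⟨Fin.cons (c * (t + 1)) fun _ ↦ c, Fin.cons (g + d * (m + 1 + t)) fun _ ↦ 0, ?_, ?_⟩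
    · simp only [Fin.sum_univ_succ, Fin.cons_zero, Fin.cons_succ, Finset.sum_const,
        Finset.card_univ, Fintype.card_fin, nsmul_eq_mul]
      push_cast at *
      linear_combination (d : ℤ) * ht + (c + 1) * hg + i * huv
    · have h : c * (t + 1) / (c + 1) ≤ t := by
        rw [← Nat.lt_succ_iff, Nat.div_lt_iff_lt_mul (by omega)]
        nlinarith
      have h' : (m + 1 + t) ≤ (g + d * (m + 1 + t)) / d := by
        rw [Nat.le_div_iff_mul_le hd]
        nlinarith
      have h'' : c / (c + 1) = 0 := Nat.div_eq_of_lt (by omega)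
      simp only [Fin.sum_univ_succ, Fin.cons_zero, Fin.cons_succ, Finset.sum_const,
        Finset.card_univ, Fintype.card_fin, nsmul_eq_mul, Nat.succ_eq_add_one, h'', Nat.zero_div,
        Nat.cast_zero, mul_zero, add_zero]
      omega

theorem exists_finsupp {m n : ℕ} (α : Fin m → ℕ) (β : Fin n → ℕ) :
    ∃ σ : (Fin m ⊕ Fin n) →₀ ℕ, (∀ a, σ (Sum.inl a) = α a) ∧ ∀ b, σ (Sum.inr b) = β b :=
  ⟨Finsupp.equivFunOnFinite.symm (Sum.elim α β), fun _ ↦ rfl, fun _ ↦ rfl⟩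

theorem first_inequality_iff {m n c d : ℕ} (hm : 0 < m) (hn : 0 < n) (hc : 0 < c) (hd : 0 < d)
    {u v : ℤ} (huv : c * u - d * v = 1) (i : ℤ) :
    1 - ⌈((m : ℚ) - v * i) / (c : ℚ)⌉ ≤ ⌈(u : ℚ) * i / (d : ℚ)⌉ ↔
      ∀ σ, degree m n c d σ = i → -(m : ℤ) < level m n c d σ := by
  have h₁ := ceil_sub_div_add_ceil_div_nonpos_iff hc hd m (v * i) (u * i)
  rw [← exists_level_le_neg_iff hm hn hc hd huv] at h₁
  push_cast at h₁
  rw [← not_iff_not]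
  have : ¬ (1 - ⌈((m : ℚ) - v * i) / (c : ℚ)⌉ ≤ ⌈(u : ℚ) * i / (d : ℚ)⌉) ↔
    ⌈((m : ℚ) - v * i) / (c : ℚ)⌉ + ⌈(u : ℚ) * i / (d : ℚ)⌉ ≤ 0 := by omega
  rw [this, h₁]
  push Not
  constructor
  · rintro ⟨α, β, h, h'⟩
    obtain ⟨σ, hα, hβ⟩ := exists_finsupp α β
    exact ⟨σ, by simpa [degree, xsum, ysum, hα, hβ] using h, by simpa [level, hα, hβ] using h'⟩
  · rintro ⟨σ, h, h'⟩
    exact ⟨fun a ↦ σ (Sum.inl a), fun b ↦ σ (Sum.inr b), h, by simpa [level] using h'⟩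

theorem second_inequality_iff {m n c d : ℕ} (hm : 0 < m) (hn : 0 < n) (hc : 0 < c) (hd : 0 < d)
    {u v : ℤ} (huv : c * u - d * v = 1) (i : ℤ) :
    1 - ⌈((n : ℚ) - u * i) / (d : ℚ)⌉ ≤ ⌈(v : ℚ) * i / (c : ℚ)⌉ ↔
      ∀ σ, degree m n c d σ = i → level m n c d σ < n := by
  have huv' : (d : ℤ) * -v - c * -u = 1 := by linarith
  have := first_inequality_iff hn hm hd hc huv' (-i)
  push_cast at this
  rw [neg_mul_neg, neg_mul_neg] at this
  rw [this]
  constructor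
  · intro h σ hσ
    obtain ⟨τ, hα, hβ⟩ := exists_finsupp (fun b ↦ σ (Sum.inr b)) (fun a ↦ σ (Sum.inl a))
    have := h τ (by rw [← hσ]; simp [degree, xsum, ysum, hα, hβ])
    simp only [level, hα, hβ] at this ⊢
    omega
  · intro h σ hσ
    obtain ⟨τ, hα, hβ⟩ := exists_finsupp (fun b ↦ σ (Sum.inr b)) (fun a ↦ σ (Sum.inl a))
    have := h τ (by
      rw [← neg_inj, ← hσ]; simp [degree, xsum, ysum, hα, hβ])
    simp only [level, hα, hβ] at this ⊢
    omega

end VeroneseSegre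

namespace VeroneseSegre

open Function RingTheory.Sequence

variable {K : Type*} [Field K] {m n c d : ℕ}

section Cells

variable {i : ℤ} {s s' : Set ℤ}

theorem eq_zero_of_forall_notMem_cell (h : ∀ σ, σ ∉ cell m n c d i s)
    {f : MvPolynomial (Fin m ⊕ Fin n) K} (hf : f ∈ supportModule K (cell m n c d i s)) : f = 0 := by
  rw [← MvPolynomial.support_eq_empty, Finset.eq_empty_iff_forall_notMem]
  exact fun σ hσ ↦ h σ (hf σ hσ)

theorem supportModule_powersFrom_eq_bot : supportModule K (powersFrom m n c d m n) = ⊥ := by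
  refine (Submodule.eq_bot_iff _).mpr fun f hf ↦ ?_
  rw [← MvPolynomial.support_eq_empty, Finset.eq_empty_iff_forall_notMem]
  intro σ hσ
  rcases hf σ hσ with ⟨a, h, -⟩ | ⟨b, h, -⟩
  · exact absurd a.2 h.not_gt
  · exact absurd b.2 h.not_gt

variable (K m n c d i s s') in
/-- The projection which discards the monomials whose level is not in `s'`. -/
noncomputable def cellProj : supportModule K (cell m n c d i s) →ₗ[SubmonoidRing K (grid m n c d)]
    supportModule K (cell m n c d i s') :=
  (supportFilter _ mem_cell_of_add_mem).restrict fun f _ ↦ supportFilter_mem _ f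

variable (K m n c d i) in
/-- The piece of level `δ` with no relations imposed. -/
noncomputable def pieceEquiv (δ : ℤ) :
    Piece K m n c d m n i δ ≃ₗ[SubmonoidRing K (grid m n c d)]
      supportModule K (cell m n c d i {δ}) :=
  Submodule.quotEquivOfEqBot _ (by
    rw [supportModule_powersFrom_eq_bot]
    exact (Submodule.eq_bot_iff _).mpr fun f hf ↦ Subtype.ext hf)

variable (K m n c d i) in
/-- The inclusion of the polynomials with levels in `s` in those with levels in `s'`. -/
noncomputable def cellIncl (h : s ⊆ s') : supportModule K (cell m n c d i s)
    →ₗ[SubmonoidRing K (grid m n c d)] supportModule K (cell m n c d i s') :=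
  Submodule.inclusion (supportModule_mono fun _ (hσ : _ ∧ _) ↦ ⟨hσ.1, h hσ.2⟩)

theorem cellProj_comp_cellIncl (h : s' ⊆ s) :
    cellProj K m n c d i s s' ∘ₗ cellIncl K m n c d i h = LinearMap.id := by
  ext1 f
  exact Subtype.ext (supportFilter_eq_self mem_cell_of_add_mem f.2)

theorem isWeaklyRegular_supportModule_Iio (hm : 0 < m) (hc : 0 < c) (hd : 0 < d)
    (h₁ : ∀ σ, degree m n c d σ = i → -(m : ℤ) < level m n c d σ) (t : ℕ) (ht : t + 1 ≤ m + n) :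
    IsWeaklyRegular (supportModule K (cell m n c d i (Set.Iio (-m + 1 + t))))
      (thetas K m n hc hd (m + n - 1) (m + n - 1)) := by
  induction t with
  | zero =>
    have : Subsingleton (supportModule K (cell m n c d i (Set.Iio (-m + 1 + (0 : ℕ))))) := by
      refine subsingleton_of_forall_eq 0 fun f ↦ Subtype.ext ?_
      refine eq_zero_of_forall_notMem_cell (fun σ hσ ↦ ?_) f.2
      have := h₁ σ hσ.1
      have : level m n c d σ < -m + 1 + (0 : ℕ) := hσ.2
      omega
    exact .of_subsingleton _
  | succ t ih =>
    have hsub : Set.Iio (-(m : ℤ) + 1 + t) ⊆ Set.Iio (-(m : ℤ) + 1 + (t + 1 : ℕ)) :=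
      Set.Iio_subset_Iio (by omega)
    have hsub' : {-(m : ℤ) + 1 + t} ⊆ Set.Iio (-(m : ℤ) + 1 + (t + 1 : ℕ)) :=
      Set.singleton_subset_iff.mpr (by simp)
    refine .of_exact _
      (cellIncl K m n c d i hsub)
      (cellProj K m n c d i _ {-(m : ℤ) + 1 + t}) (Submodule.inclusion_injective _) ?_ ?_
      (ih (by omega)) ?_
    · intro f
      constructor
      · intro hf
        have := (supportFilter_eq_zero_iff mem_cell_of_add_mem).mp (congrArg Subtype.val hf)
        refine ⟨⟨f.1, fun σ hσ ↦ ⟨(f.2 σ hσ).1, ?_⟩⟩, rfl⟩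
        have h : level m n c d σ < -(m : ℤ) + 1 + (t + 1 : ℕ) := (f.2 σ hσ).2
        have h' : level m n c d σ ≠ -(m : ℤ) + 1 + t :=
          fun h' ↦ this σ hσ ⟨(f.2 σ hσ).1, h'⟩
        rw [Set.mem_Iio]
        omega
      · rintro ⟨g, rfl⟩
        refine Subtype.ext ((supportFilter_eq_zero_iff mem_cell_of_add_mem).mpr fun σ hσ h ↦ ?_)
        have h' : level m n c d σ < -(m : ℤ) + 1 + t := (g.2 σ hσ).2
        exact h'.ne h.2
    · exact fun f ↦ ⟨_, LinearMap.congr_fun (cellProj_comp_cellIncl hsub') f⟩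
    · rw [← (pieceEquiv K m n c d i _).isWeaklyRegular_congr]
      exact isWeaklyRegular_piece hc hd le_rfl le_rfl _ _ _ (by omega) (by omega) (by omega)

theorem isWeaklyRegular_supportModule (hm : 0 < m) (hc : 0 < c) (hd : 0 < d)
    (h₁ : ∀ σ, degree m n c d σ = i → -(m : ℤ) < level m n c d σ)
    (h₂ : ∀ σ, degree m n c d σ = i → level m n c d σ < n) :
    IsWeaklyRegular (supportModule K (cell m n c d i Set.univ))
      (thetas K m n hc hd (m + n - 1) (m + n - 1)) := by
  have := isWeaklyRegular_supportModule_Iio (K := K) hm hc hd h₁ (m + n - 1) (by omega)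
  have h : cell m n c d i (Set.Iio (-m + 1 + (m + n - 1 : ℕ))) = cell m n c d i Set.univ := by
    ext σ
    refine and_congr_right fun hσ ↦ iff_of_true ?_ trivial
    have := h₂ σ hσ
    rw [Set.mem_Iio]
    omega
  rwa [h] at this

end Cells

end VeroneseSegre

namespace ModuleCat

open CategoryTheory Abelian

universe u

/-- If `Hom(T ⧸ I, N) = 0`, then `N` has no nonzero element killed by `I`. -/
theorem eq_zero_of_subsingleton_ext_zero {T N : Type u} [CommRing T] [AddCommGroup N] [Module T N]
    {I : Ideal T} (h : Subsingleton (Ext (ModuleCat.of T (T ⧸ I)) (ModuleCat.of T N) 0)) {x : N}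
    (hx : ∀ t ∈ I, t • x = 0) : x = 0 := by
  let f : T ⧸ I →ₗ[T] N := Submodule.liftQ I (LinearMap.toSpanSingleton T N x) hx
  have hf : ModuleCat.ofHom f = 0 := (Ext.mk₀_bijective _ _).injective (Subsingleton.elim _ _)
  have : f (Submodule.Quotient.mk 1) = 0 := by
    rw [show f = 0 from congrArg ModuleCat.Hom.hom hf, LinearMap.zero_apply]
  rwa [show f (Submodule.Quotient.mk 1) = LinearMap.toSpanSingleton T N x 1 from rfl,
    LinearMap.toSpanSingleton_apply, one_smul] at this

end ModuleCat

namespace VeroneseSegre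

open CategoryTheory Abelian Function RingTheory.Sequence

universe u

variable {K : Type u} [Field K] {m n c d : ℕ}

theorem exists_le_inl_of_mem_grid {τ : (Fin m ⊕ Fin n) →₀ ℕ}
    (hτ : τ ∈ grid m n c d) (h : τ ≠ 0) : ∃ a, c ≤ τ (Sum.inl a) := by
  by_contra! h'
  obtain ⟨h₁, h₂, -, h₄⟩ := hτ
  have h₅ : ∀ a, τ (Sum.inl a) = 0 := fun a ↦ Nat.eq_zero_of_dvd_of_lt (h₁ a) (h' a)
  simp only [level, h₅, Nat.zero_div, Nat.cast_zero, Finset.sum_const_zero, zero_sub, neg_eq_zero,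
    ← Nat.cast_sum, Nat.cast_eq_zero, Finset.sum_eq_zero_iff, Finset.mem_univ, forall_const] at h₄
  refine h (Finsupp.ext fun s ↦ ?_)
  rcases s with a | b
  · exact h₅ a
  · exact Nat.eq_zero_of_dvd_of_div_eq_zero (h₂ b) (h₄ b)

theorem exists_le_inr_of_mem_grid {τ : (Fin m ⊕ Fin n) →₀ ℕ}
    (hτ : τ ∈ grid m n c d) (h : τ ≠ 0) : ∃ b, d ≤ τ (Sum.inr b) := by
  by_contra! h'
  obtain ⟨h₁, h₂, -, h₄⟩ := hτ
  have h₅ : ∀ b, τ (Sum.inr b) = 0 := fun b ↦ Nat.eq_zero_of_dvd_of_lt (h₂ b) (h' b)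
  simp only [level, h₅, Nat.zero_div, Nat.cast_zero, Finset.sum_const_zero, sub_zero,
    ← Nat.cast_sum, Nat.cast_eq_zero, Finset.sum_eq_zero_iff, Finset.mem_univ, forall_const] at h₄
  refine h (Finsupp.ext fun s ↦ ?_)
  rcases s with a | b
  · exact Nat.eq_zero_of_dvd_of_div_eq_zero (h₁ a) (h₄ a)
  · exact h₅ b

theorem degree_eq_mod_add (σ : (Fin m ⊕ Fin n) →₀ ℕ) :
    degree m n c d σ = d * ∑ a : Fin m, ((σ (Sum.inl a) % c : ℕ) : ℤ) -
      c * ∑ b : Fin n, ((σ (Sum.inr b) % d : ℕ) : ℤ) + c * d * level m n c d σ := by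
  have h₁ : xsum m n σ = c * ∑ a : Fin m, ((σ (Sum.inl a) / c : ℕ) : ℤ) +
      ∑ a : Fin m, ((σ (Sum.inl a) % c : ℕ) : ℤ) := by
    rw [Finset.mul_sum, ← Finset.sum_add_distrib]
    exact Finset.sum_congr rfl fun a _ ↦ by exact_mod_cast (Nat.div_add_mod _ _).symm
  have h₂ : ysum m n σ = d * ∑ b : Fin n, ((σ (Sum.inr b) / d : ℕ) : ℤ) +
      ∑ b : Fin n, ((σ (Sum.inr b) % d : ℕ) : ℤ) := by
    rw [Finset.mul_sum, ← Finset.sum_add_distrib]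
    exact Finset.sum_congr rfl fun a _ ↦ by exact_mod_cast (Nat.div_add_mod _ _).symm
  rw [degree, level, h₁, h₂]
  ring

theorem exists_notMem_powersFrom_zero_left (hn : 0 < n) (hc : 0 < c) (hd : 0 < d)
    {σ : (Fin m ⊕ Fin n) →₀ ℕ} (h : level m n c d σ ≤ 0) :
    ∃ σ' ∈ cell m n c d (degree m n c d σ) {level m n c d σ},
      σ' ∉ powersFrom m n c d 0 n := by
  obtain ⟨k, hk⟩ := Int.eq_ofNat_of_zero_le (neg_nonneg.mpr h)
  obtain ⟨τ, hα, hβ⟩ := exists_finsupp (fun a ↦ σ (Sum.inl a) % c)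
    (fun b ↦ σ (Sum.inr b) % d + d * if b = ⟨0, hn⟩ then k else 0)
  have hlevel : level m n c d τ = level m n c d σ := by
    rw [← neg_neg (level m n c d σ), hk]
    simp only [level, hα, hβ, Nat.div_eq_of_lt (Nat.mod_lt _ hc), Nat.add_mul_div_left _ _ hd,
      Nat.div_eq_of_lt (Nat.mod_lt _ hd)]
    simp
  refine ⟨τ, ⟨?_, hlevel⟩, ?_⟩
  · rw [degree_eq_mod_add, degree_eq_mod_add σ, hlevel]
    simp only [hα, hβ, Nat.mod_mod, Nat.add_mul_mod_self_left]
  · rintro (⟨a, -, ha⟩ | ⟨b, hb, -⟩)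
    · exact (Nat.mod_lt _ hc).not_ge (hα a ▸ ha)
    · exact b.2.not_ge hb

theorem exists_notMem_powersFrom_zero_right (hm : 0 < m) (hc : 0 < c) (hd : 0 < d)
    {σ : (Fin m ⊕ Fin n) →₀ ℕ} (h : 0 ≤ level m n c d σ) :
    ∃ σ' ∈ cell m n c d (degree m n c d σ) {level m n c d σ},
      σ' ∉ powersFrom m n c d m 0 := by
  obtain ⟨k, hk⟩ := Int.eq_ofNat_of_zero_le h
  obtain ⟨τ, hα, hβ⟩ := exists_finsupp
    (fun a ↦ σ (Sum.inl a) % c + c * if a = ⟨0, hm⟩ then k else 0) (fun b ↦ σ (Sum.inr b) % d)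
  have hlevel : level m n c d τ = level m n c d σ := by
    rw [hk]
    simp only [level, hα, hβ, Nat.div_eq_of_lt (Nat.mod_lt _ hd), Nat.add_mul_div_left _ _ hc,
      Nat.div_eq_of_lt (Nat.mod_lt _ hc)]
    simp
  refine ⟨τ, ⟨?_, hlevel⟩, ?_⟩
  · rw [degree_eq_mod_add, degree_eq_mod_add σ, hlevel]
    simp only [hα, hβ, Nat.mod_mod, Nat.add_mul_mod_self_left]
  · rintro (⟨a, ha, -⟩ | ⟨b, -, hb⟩)
    · exact a.2.not_ge ha
    · exact (Nat.mod_lt _ hd).not_ge (hβ b ▸ hb)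

variable (K m n c d) in
/-- The ideal of the polynomials without constant coefficient. -/
noncomputable def augmentationIdeal : Ideal (SubmonoidRing K (grid m n c d)) :=
  RingHom.ker (constantCoeff.comp (algebraMap _ (MvPolynomial (Fin m ⊕ Fin n) K)))

theorem theta_mem_augmentationIdeal (hc : 0 < c) (hd : 0 < d) (k : ℕ) :
    theta K m n hc hd k ∈ augmentationIdeal K m n c d := by
  refine RingHom.mem_ker.mpr ?_
  rw [RingHom.comp_apply, theta, SubmonoidRing.algebraMap_mk, map_sum]
  refine Finset.sum_eq_zero fun x _ ↦ ?_
  rw [constantCoeff_monomial, if_neg]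
  intro h
  have := DFunLike.congr_fun h (Sum.inl x.1)
  simp at this
  omega

theorem smul_mem_supportModule {t : SubmonoidRing K (grid m n c d)}
    (ht : t ∈ augmentationIdeal K m n c d) {σ : (Fin m ⊕ Fin n) →₀ ℕ}
    {J : SubAddAction (grid m n c d) ((Fin m ⊕ Fin n) →₀ ℕ)}
    (hJ : ∀ τ ∈ grid m n c d, τ ≠ 0 → τ + σ ∈ J) : t • monomial σ (1 : K) ∈ supportModule K J := by
  classical
  intro ρ hρ
  rw [Algebra.smul_def] at hρ
  obtain ⟨τ, hτ, σ', hσ', rfl⟩ := Finset.mem_add.mp (support_mul _ _ hρ)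
  rw [Finset.mem_singleton.mp (support_monomial_subset hσ')]
  refine hJ τ (t.mem_of_mem_support hτ) ?_
  rintro rfl
  exact mem_support_iff.mp hτ ht

variable (K m n c d) in
/-- The vanishing of `Extʲ(T/𝔱, N)` for the augmentation ideal `𝔱` of the ring `T` of polynomials
with exponents in the grid. -/
def ExtVanishes (N : Type u) [AddCommGroup N] [Module (SubmonoidRing K (grid m n c d)) N]
    (j : ℕ) : Prop :=
  Subsingleton (Ext (ModuleCat.of (SubmonoidRing K (grid m n c d))
    (SubmonoidRing K (grid m n c d) ⧸ augmentationIdeal K m n c d)) (ModuleCat.of _ N) j)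

theorem mem_powersFrom_of_extVanishes {p q : ℕ} {i δ : ℤ} {σ : (Fin m ⊕ Fin n) →₀ ℕ}
    (h : ExtVanishes K m n c d (Piece K m n c d p q i δ) 0) (hσ : σ ∈ cell m n c d i {δ})
    (hJ : ∀ τ ∈ grid m n c d, τ ≠ 0 → τ + σ ∈ powersFrom m n c d p q) :
    σ ∈ powersFrom m n c d p q := by
  classical
  have hsupp (ρ) (hρ : ρ ∈ (monomial σ (1 : K)).support) : ρ = σ :=
    Finset.mem_singleton.mp (support_monomial_subset hρ)
  let f : supportModule K (cell m n c d i {δ}) := ⟨monomial σ 1, fun ρ hρ ↦ hsupp ρ hρ ▸ hσ⟩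
  have hf : (Submodule.Quotient.mk f : Piece K m n c d p q i δ) = 0 :=
    ModuleCat.eq_zero_of_subsingleton_ext_zero h fun t ht ↦
      (Submodule.Quotient.mk_eq_zero _).mpr (smul_mem_supportModule ht hJ)
  exact (Subquotient.mk_eq_zero_iff f).mp hf σ (by simp [f])

theorem extVanishes_piece (hc : 0 < c) (hd : 0 < d) {p q : ℕ} (hp : p ≤ m) (hq : q ≤ n)
    {i δ : ℤ} {j k : ℕ} (hk : k < j) (hj : j + 1 ≤ p + q) (h₁ : δ < q ∨ j ≤ q)
    (h₂ : -(p : ℤ) < δ ∨ j ≤ p) : ExtVanishes K m n c d (Piece K m n c d p q i δ) k := by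
  refine ModuleCat.subsingleton_ext_of_isWeaklyRegular _ (thetas K m n hc hd (p + q - 1) j)
    (fun x hx ↦ ?_) _ (isWeaklyRegular_piece hc hd hp hq i δ j (.inr hj) h₁ h₂) k
    (by rwa [length_thetas hc hd (by omega)])
  obtain ⟨l, rfl⟩ := mem_thetas hc hd hx
  refine Ideal.le_radical (Ideal.mem_map_of_mem _ ?_)
  rw [Ideal.annihilator_quotient]
  exact theta_mem_augmentationIdeal hc hd l

theorem neg_lt_level_of_extVanishes (hn : 2 ≤ n) (hc : 0 < c) (hd : 0 < d) {p : ℕ} (hp : p ≤ m)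
    (σ : (Fin m ⊕ Fin n) →₀ ℕ)
    (h : ExtVanishes K m n c d
      (Piece K m n c d p n (degree m n c d σ) (level m n c d σ)) p) :
    -(p : ℤ) < level m n c d σ := by
  induction p generalizing σ with
  | zero =>
    by_contra! hσ
    obtain ⟨τ, hτ, hτ'⟩ := exists_notMem_powersFrom_zero_left (by omega) hc hd
      (hσ.trans_eq (by simp))
    refine hτ' (mem_powersFrom_of_extVanishes h hτ fun ρ hρ h₀ ↦ ?_)
    obtain ⟨a, ha⟩ := exists_le_inl_of_mem_grid hρ h₀
    exact .inl ⟨a, Nat.zero_le _, ha.trans (Nat.le_add_right _ _)⟩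
  | succ p ih =>
    by_contra! hσ
    push_cast at hσ
    have := ih (Nat.le_of_succ_le hp) (Finsupp.single (Sum.inl ⟨p, hp⟩) c + σ) ?_
    · rw [level_single_inl_add hc] at this
      omega
    · rw [level_single_inl_add hc, degree_single_inl_add]
      exact ModuleCat.subsingleton_ext_of_exact _ _ _ (mulX_injective hc ⟨p, hp⟩ n rfl rfl)
        (exact_mulX_proj hc ⟨p, hp⟩ n rfl rfl) (Subquotient.proj_surjective _) p
        (extVanishes_piece hc hd hp le_rfl p.lt_succ_self (by omega) (by omega) (by omega)) h

theorem level_lt_of_extVanishes (hm : 2 ≤ m) (hc : 0 < c) (hd : 0 < d) {q : ℕ} (hq : q ≤ n)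
    (σ : (Fin m ⊕ Fin n) →₀ ℕ)
    (h : ExtVanishes K m n c d
      (Piece K m n c d m q (degree m n c d σ) (level m n c d σ)) q) :
    level m n c d σ < q := by
  induction q generalizing σ with
  | zero =>
    by_contra! hσ
    obtain ⟨τ, hτ, hτ'⟩ := exists_notMem_powersFrom_zero_right (by omega) hc hd hσ
    refine hτ' (mem_powersFrom_of_extVanishes h hτ fun ρ hρ h₀ ↦ ?_)
    obtain ⟨a, ha⟩ := exists_le_inr_of_mem_grid hρ h₀
    exact .inr ⟨a, Nat.zero_le _, ha.trans (Nat.le_add_right _ _)⟩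
  | succ q ih =>
    by_contra! hσ
    push_cast at hσ
    have := ih (Nat.le_of_succ_le hq) (Finsupp.single (Sum.inr ⟨q, hq⟩) d + σ) ?_
    · rw [level_single_inr_add hd] at this
      omega
    · rw [level_single_inr_add hd, degree_single_inr_add]
      exact ModuleCat.subsingleton_ext_of_exact _ _ _ (mulY_injective hd m ⟨q, hq⟩ rfl rfl)
        (exact_mulY_proj hd m ⟨q, hq⟩ rfl rfl) (Subquotient.proj_surjective _) q
        (extVanishes_piece hc hd le_rfl hq q.lt_succ_self (by omega) (by omega) (by omega)) h

theorem extVanishes_piece_of_supportModule {i : ℤ} (δ : ℤ) {j : ℕ}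
    (h : ExtVanishes K m n c d (supportModule K (cell m n c d i Set.univ)) j) :
    ExtVanishes K m n c d (Piece K m n c d m n i δ) j :=
  ModuleCat.subsingleton_ext_of_retract _
    (cellIncl K m n c d i (Set.subset_univ {δ}) ∘ₗ (pieceEquiv K m n c d i δ).toLinearMap)
    ((pieceEquiv K m n c d i δ).symm.toLinearMap ∘ₗ cellProj K m n c d i _ {δ}) (by
      rw [LinearMap.comp_assoc, ← LinearMap.comp_assoc _ _ (cellProj _ _ _ _ _ _ _ _),
        cellProj_comp_cellIncl, LinearMap.id_comp, LinearEquiv.symm_comp]) _ h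

end VeroneseSegre

namespace VeroneseSegre

section Ring

variable {K : Type*} [Field K] {m n c d : ℕ}

variable (m n c d) in
/-- The exponents of the monomials of degree zero. -/
def degreeZero : AddSubmonoid ((Fin m ⊕ Fin n) →₀ ℕ) where
  carrier := {τ | degree m n c d τ = 0}
  add_mem' {τ σ} (h : _ = _) (h' : _ = _) := by
    rw [Set.mem_ofPred_eq, degree_add, h, h', add_zero]
  zero_mem' := by simp [degree, xsum, ysum]

theorem monomial_mem_veroneseSegreRing {σ : (Fin m ⊕ Fin n) →₀ ℕ} (h : degree m n c d σ = 0) :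
    monomial σ (1 : K) ∈ veroneseSegreRing K m n c d :=
  Algebra.subset_adjoin ⟨σ, sub_eq_zero.mp h, rfl⟩

theorem mem_veroneseSegreRing_iff {f : MvPolynomial (Fin m ⊕ Fin n) K} :
    f ∈ veroneseSegreRing K m n c d ↔ ∀ σ ∈ f.support, degree m n c d σ = 0 := by
  classical
  constructor
  · suffices veroneseSegreRing K m n c d ≤ submonoidSubalgebra K (degreeZero m n c d) from
      fun hf ↦ this hf
    refine Algebra.adjoin_le ?_
    rintro _ ⟨σ, hσ, rfl⟩ τ hτ
    rw [Finset.mem_singleton.mp (support_monomial_subset hτ)]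
    exact sub_eq_zero.mpr hσ
  · intro hf
    rw [f.as_sum]
    refine sum_mem fun σ hσ ↦ ?_
    rw [← mul_one (coeff σ f), ← smul_eq_mul, ← smul_monomial]
    exact Subalgebra.smul_mem _ (monomial_mem_veroneseSegreRing (hf σ hσ)) _

theorem mem_veroneseSegreClassModule_iff {i : ℤ} {f : MvPolynomial (Fin m ⊕ Fin n) K} :
    f ∈ veroneseSegreClassModule K m n c d i ↔ ∀ σ ∈ f.support, degree m n c d σ = i := by
  classical
  constructor
  · intro hf
    induction hf using Submodule.span_induction with
    | mem f hf =>
      obtain ⟨σ, hσ, rfl⟩ := hf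
      intro τ hτ
      rwa [Finset.mem_singleton.mp (support_monomial_subset hτ)]
    | zero => simp
    | add f g _ _ hf hg =>
      exact fun σ hσ ↦ (Finset.mem_union.mp (support_add hσ)).elim (hf σ) (hg σ)
    | smul r f _ hf =>
      intro σ hσ
      rw [Algebra.smul_def] at hσ
      obtain ⟨τ, hτ, ρ, hρ, rfl⟩ := Finset.mem_add.mp (support_mul _ _ hσ)
      rw [degree_add, mem_veroneseSegreRing_iff.mp r.2 τ hτ, hf ρ hρ, zero_add]
  · intro hf
    rw [f.as_sum]
    refine sum_mem fun σ hσ ↦ ?_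
    rw [← mul_one (coeff σ f), ← smul_eq_mul, ← smul_monomial]
    exact Submodule.smul_of_tower_mem _ _ (Submodule.subset_span ⟨σ, hf σ hσ, rfl⟩)

theorem mem_veroneseSegreIrrelevantIdeal_iff {r : veroneseSegreRing K m n c d} :
    r ∈ veroneseSegreIrrelevantIdeal K m n c d ↔
      constantCoeff (r : MvPolynomial (Fin m ⊕ Fin n) K) = 0 := by
  classical
  constructor
  · intro hr
    induction hr using Submodule.span_induction with
    | mem r hr =>
      obtain ⟨σ, hσ, h⟩ := hr
      rw [h, constantCoeff_monomial, if_neg hσ]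
    | zero => simp
    | add r s _ _ hr hs => simp [hr, hs]
    | smul r s _ hs => simp [hs]
  · intro h
    have hr : r = ∑ σ ∈ (r : MvPolynomial (Fin m ⊕ Fin n) K).support.attach,
        coeff σ.1 (r : MvPolynomial (Fin m ⊕ Fin n) K) • (⟨monomial σ.1 1,
          monomial_mem_veroneseSegreRing (mem_veroneseSegreRing_iff.mp r.2 σ.1 σ.2)⟩ :
            veroneseSegreRing K m n c d) := by
      refine Subtype.ext ?_
      rw [AddSubmonoidClass.coe_finsetSum]
      simp only [Subalgebra.coe_smul, smul_monomial, smul_eq_mul, mul_one]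
      rw [Finset.sum_attach _ fun σ ↦ monomial σ (coeff σ _)]
      exact as_sum _
    rw [hr]
    refine sum_mem fun σ _ ↦ Submodule.smul_of_tower_mem _ _ (Ideal.subset_span ⟨σ.1, ?_, rfl⟩)
    intro h₀
    exact mem_support_iff.mp σ.2 (h₀ ▸ h)

noncomputable instance : Algebra (SubmonoidRing K (grid m n c d)) (veroneseSegreRing K m n c d) :=
  ((algebraMap (SubmonoidRing K (grid m n c d)) (MvPolynomial (Fin m ⊕ Fin n) K)).codRestrict
    (veroneseSegreRing K m n c d) fun t ↦ mem_veroneseSegreRing_iff.mpr fun _ hσ ↦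
      (t.mem_of_mem_support hσ).2.2.1).toAlgebra

instance : IsScalarTower (SubmonoidRing K (grid m n c d)) (veroneseSegreRing K m n c d)
    (MvPolynomial (Fin m ⊕ Fin n) K) :=
  .of_algebraMap_eq fun _ ↦ rfl

variable (K m n c d) in
/-- The class module, as a module over the ring of polynomials with exponents in the grid. -/
noncomputable def classModuleEquiv (i : ℤ) : supportModule K (cell m n c d i Set.univ)
    ≃ₗ[SubmonoidRing K (grid m n c d)] veroneseSegreClassModule K m n c d i where
  toFun f := ⟨f.1, mem_veroneseSegreClassModule_iff.mpr fun σ hσ ↦ (f.2 σ hσ).1⟩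
  invFun f := ⟨f.1, fun σ hσ ↦ ⟨mem_veroneseSegreClassModule_iff.mp f.2 σ hσ, trivial⟩⟩
  map_add' _ _ := rfl
  map_smul' _ _ := rfl
  left_inv _ := rfl
  right_inv _ := rfl

theorem nsmul_mem_grid (hc : 0 < c) (hd : 0 < d) {σ : (Fin m ⊕ Fin n) →₀ ℕ}
    (h : degree m n c d σ = 0) : (c * d) • σ ∈ grid m n c d := by
  refine ⟨fun a ↦ ⟨d * σ (Sum.inl a), by simp [mul_assoc]⟩,
    fun b ↦ ⟨c * σ (Sum.inr b), by simp; ring⟩,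
    (degreeZero m n c d).nsmul_mem h (c * d), ?_⟩
  have h₁ (x : ℕ) : c * d * x / c = d * x := by rw [mul_assoc, Nat.mul_div_cancel_left _ hc]
  have h₂ (x : ℕ) : c * d * x / d = c * x := by
    rw [mul_comm c d, mul_assoc, Nat.mul_div_cancel_left _ hd]
  simpa [level, h₁, h₂, degree, xsum, ysum, Finset.mul_sum] using h

theorem mem_radical_map_augmentationIdeal (hc : 0 < c) (hd : 0 < d)
    {r : veroneseSegreRing K m n c d} (hr : r ∈ veroneseSegreIrrelevantIdeal K m n c d) :
    r ∈ ((augmentationIdeal K m n c d).map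
      (algebraMap _ (veroneseSegreRing K m n c d))).radical := by
  classical
  suffices veroneseSegreIrrelevantIdeal K m n c d ≤ ((augmentationIdeal K m n c d).map
      (algebraMap _ (veroneseSegreRing K m n c d))).radical from this hr
  refine Ideal.span_le.mpr ?_
  rintro r ⟨σ, hσ, h⟩
  have hσ' := mem_veroneseSegreRing_iff.mp r.2 σ (by rw [h, mem_support_iff]; simp)
  let t : SubmonoidRing K (grid m n c d) := .mk (monomial ((c * d) • σ) 1) fun τ hτ ↦ by
    rw [Finset.mem_singleton.mp (support_monomial_subset hτ)]
    exact nsmul_mem_grid hc hd hσ'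
  refine ⟨c * d, ?_⟩
  have ht : r ^ (c * d) = algebraMap _ _ t := Subtype.ext (by
    rw [SubmonoidClass.coe_pow, h, monomial_pow, one_pow]
    rfl)
  rw [ht]
  refine Ideal.mem_map_of_mem _ (RingHom.mem_ker.mpr ?_)
  rw [RingHom.comp_apply, SubmonoidRing.algebraMap_mk, constantCoeff_monomial, if_neg]
  exact smul_ne_zero (mul_pos hc hd).ne' hσ

theorem exists_degree_eq (hm : 0 < m) (hn : 0 < n) (hc : 0 < c) (hd : 0 < d) {u v : ℤ}
    (huv : c * u - d * v = 1) (i : ℤ) : ∃ σ, degree m n c d σ = i := by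
  have h₁ : 0 ≤ c * (|u * i| + |v * i|) - v * i := by
    nlinarith [le_abs_self (v * i), abs_nonneg (u * i), abs_nonneg (v * i)]
  have h₂ : 0 ≤ d * (|u * i| + |v * i|) - u * i := by
    nlinarith [le_abs_self (u * i), abs_nonneg (u * i), abs_nonneg (v * i)]
  obtain ⟨x, hx⟩ := Int.eq_ofNat_of_zero_le h₁
  obtain ⟨y, hy⟩ := Int.eq_ofNat_of_zero_le h₂
  obtain ⟨σ, hα, hβ⟩ := exists_finsupp (fun a : Fin m ↦ if a = ⟨0, hm⟩ then x else 0)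
    (fun b : Fin n ↦ if b = ⟨0, hn⟩ then y else 0)
  refine ⟨σ, ?_⟩
  simp only [degree, xsum, ysum, hα, hβ, Nat.cast_ite, Nat.cast_zero, Finset.sum_ite_eq',
    Finset.mem_univ, if_true, ← hx, ← hy]
  linear_combination i * huv

theorem smul_top_ne_top {i : ℤ} (h : ∃ σ, degree m n c d σ = i)
    {I : Ideal (veroneseSegreRing K m n c d)} (hI : I ≤ veroneseSegreIrrelevantIdeal K m n c d) :
    I • (⊤ : Submodule (veroneseSegreRing K m n c d) (veroneseSegreClassModule K m n c d i)) ≠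
      ⊤ := by
  classical
  intro htop
  obtain ⟨σ, hσ, hmin⟩ := exists_minimal_of_wellFoundedLT (fun σ ↦ degree m n c d σ = i) h
  have key (x : veroneseSegreClassModule K m n c d i) (hx : x ∈ I • (⊤ : Submodule
      (veroneseSegreRing K m n c d) (veroneseSegreClassModule K m n c d i))) :
      coeff σ (x : MvPolynomial (Fin m ⊕ Fin n) K) = 0 := by
    induction hx using Submodule.smul_induction_on' with
    | smul r hr x hx =>
      by_contra hne
      rw [Submodule.coe_smul, Algebra.smul_def, ← ne_eq, ← mem_support_iff] at hne
      obtain ⟨τ, hτ, ρ, hρ, hτρ⟩ := Finset.mem_add.mp (support_mul _ _ hne)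
      have hle := hmin (mem_veroneseSegreClassModule_iff.mp x.2 ρ hρ)
        (hτρ ▸ le_add_of_nonneg_left zero_le)
      have hτ₀ : τ = 0 := by
        rw [← hτρ] at hle
        ext s
        have := hle s
        simpa using this
      subst hτ₀
      exact mem_support_iff.mp hτ (mem_veroneseSegreIrrelevantIdeal_iff.mp (hI hr))
    | add x hx y hy hx' hy' => rw [Submodule.coe_add, coeff_add, hx', hy', add_zero]
  have := key ⟨monomial σ 1, Submodule.subset_span ⟨σ, hσ, rfl⟩⟩ (by rw [htop]; trivial)
  simp at this

end Ring

end VeroneseSegre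

namespace VeroneseSegre

open RingTheory.Sequence

universe u

variable {K : Type u} [Field K] {m n c d : ℕ}

theorem isRegular_map_thetas (hm : 0 < m) (hc : 0 < c) (hd : 0 < d) {i : ℤ}
    (h : ∃ σ, degree m n c d σ = i)
    (h₁ : ∀ σ, degree m n c d σ = i → -(m : ℤ) < level m n c d σ)
    (h₂ : ∀ σ, degree m n c d σ = i → level m n c d σ < n) :
    ∃ xs : List (veroneseSegreRing K m n c d), xs.length = m + n - 1 ∧
      (∀ x ∈ xs, x ∈ veroneseSegreIrrelevantIdeal K m n c d) ∧
      IsRegular (veroneseSegreClassModule K m n c d i) xs := by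
  have hmem : ∀ x ∈ (thetas K m n hc hd (m + n - 1) (m + n - 1)).map
      (algebraMap _ (veroneseSegreRing K m n c d)), x ∈ veroneseSegreIrrelevantIdeal K m n c d := by
    intro x hx
    obtain ⟨t, ht, rfl⟩ := List.mem_map.mp hx
    obtain ⟨l, rfl⟩ := mem_thetas hc hd ht
    exact mem_veroneseSegreIrrelevantIdeal_iff.mpr (theta_mem_augmentationIdeal hc hd l)
  refine ⟨_, by rw [List.length_map, length_thetas hc hd le_rfl], hmem, ?_, ?_⟩
  · rw [isWeaklyRegular_map_algebraMap_iff, ← (classModuleEquiv K m n c d i).isWeaklyRegular_congr]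
    exact isWeaklyRegular_supportModule hm hc hd h₁ h₂
  · exact (smul_top_ne_top h (Ideal.span_le.mpr hmem)).symm

theorem extVanishes_of_isWeaklyRegular (hc : 0 < c) (hd : 0 < d) {i : ℤ}
    {xs : List (veroneseSegreRing K m n c d)}
    (hmem : ∀ x ∈ xs, x ∈ veroneseSegreIrrelevantIdeal K m n c d)
    (hxs : IsWeaklyRegular (veroneseSegreClassModule K m n c d i) xs) {j : ℕ}
    (hj : j < xs.length) :
    ExtVanishes K m n c d (supportModule K (cell m n c d i Set.univ)) j := by
  refine ModuleCat.subsingleton_ext_of_retract _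
    (classModuleEquiv K m n c d i).toLinearMap (classModuleEquiv K m n c d i).symm.toLinearMap
    (LinearEquiv.symm_comp _) j
    (ModuleCat.subsingleton_ext_of_isWeaklyRegular _ xs (fun x hx ↦ ?_) _ hxs j hj)
  rw [Ideal.annihilator_quotient]
  exact mem_radical_map_augmentationIdeal hc hd (hmem x hx)

theorem exists_isRegular_iff (hm : 2 ≤ m) (hn : 2 ≤ n) (hc : 1 ≤ c) (hd : 1 ≤ d) {u v : ℤ}
    (huv : (c : ℤ) * u - (d : ℤ) * v = 1) (i : ℤ) :
    (∃ xs : List (veroneseSegreRing K m n c d), xs.length = m + n - 1 ∧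
      (∀ x ∈ xs, x ∈ veroneseSegreIrrelevantIdeal K m n c d) ∧
      IsRegular (veroneseSegreClassModule K m n c d i) xs) ↔
    (1 - ⌈((m : ℚ) - v * i) / (c : ℚ)⌉ ≤ ⌈(u : ℚ) * i / (d : ℚ)⌉ ∧
     1 - ⌈((n : ℚ) - u * i) / (d : ℚ)⌉ ≤ ⌈(v : ℚ) * i / (c : ℚ)⌉) := by
  have hm₀ : 0 < m := by omega
  have hn₀ : 0 < n := by omega
  rw [first_inequality_iff hm₀ hn₀ hc hd huv, second_inequality_iff hm₀ hn₀ hc hd huv]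
  constructor
  · rintro ⟨xs, hlen, hmem, hxs⟩
    have hvan (δ : ℤ) (j : ℕ) (hj : j < m + n - 1) :=
      extVanishes_piece_of_supportModule δ
        (extVanishes_of_isWeaklyRegular hc hd hmem hxs.toIsWeaklyRegular (hlen ▸ hj))
    constructor
    · rintro σ rfl
      exact neg_lt_level_of_extVanishes hn hc hd le_rfl σ (hvan _ _ (by omega))
    · rintro σ rfl
      exact level_lt_of_extVanishes hm hc hd le_rfl σ (hvan _ _ (by omega))
  · rintro ⟨h₁, h₂⟩
    exact isRegular_map_thetas hm₀ hc hd (exists_degree_eq hm₀ hn₀ hc hd huv i) h₁ h₂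

end VeroneseSegre

/-- There is a regular sequence on `M_i` of length `m+n-1` (the Krull dimension of `R`)
consisting of elements of the irrelevant maximal ideal `𝔪` of `R` — i.e. `M_i` is a
Cohen–Macaulay `R`-module — if and only if both inequalities
`1 - ⌈(m - vi)/c⌉ ≤ ⌈ui/d⌉` and `1 - ⌈(n - ui)/d⌉ ≤ ⌈vi/c⌉` hold
(the Stückrad–Vogel criterion). -/
theorem veroneseSegreClassModule_cohenMacaulay_iff (K : Type*) [Field K] (m n c d : ℕ)
    (hm : 2 ≤ m) (hn : 2 ≤ n) (hc : 1 ≤ c) (hd : 1 ≤ d) (hcd : Nat.Coprime c d)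
    (u v : ℤ) (hu : 1 ≤ u) (hv : 1 ≤ v) (huv : (c : ℤ) * u - (d : ℤ) * v = 1) (i : ℤ) :
    (∃ xs : List (veroneseSegreRing K m n c d), xs.length = m + n - 1 ∧
      (∀ x ∈ xs, x ∈ veroneseSegreIrrelevantIdeal K m n c d) ∧
      RingTheory.Sequence.IsRegular (veroneseSegreClassModule K m n c d i) xs) ↔
    (1 - ⌈((m : ℚ) - v * i) / (c : ℚ)⌉ ≤ ⌈(u : ℚ) * i / (d : ℚ)⌉ ∧
     1 - ⌈((n : ℚ) - u * i) / (d : ℚ)⌉ ≤ ⌈(v : ℚ) * i / (c : ℚ)⌉) :=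
  VeroneseSegre.exists_isRegular_iff hm hn hc hd huv i
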